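/- arXiv:1003.4762 — 5 statements merged into one kernel-verified Lean document; each statement's English description precedes it below -/
import Mathlib

section
/- Let G be a relatively free group of infinite rank κ, formalized as G = FreeGroup X ⧸ V with X infinite and V fully invariant, let X̄ be the basis of G given by the images of the generators, let Γ = Aut G, and let Σ be a subgroup of Γ such that the cardinality of the coset space Γ/Σ is at most κ = #X. Then there is a subset U of X̄ of cardinality strictly less than κ such that every permutational automorphism of G with respect to X̄ that fixes U pointwise belongs to Σ. -/
open Cardinal

/-- The basis of the relatively free group `FreeGroup X ⧸ V` given by the images of
the generators. -/
def genBasis {X : Type*} (V : Subgroup (FreeGroup X)) : Set (FreeGroup X ⧸ V) :=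
  Set.range fun x : X => (QuotientGroup.mk (FreeGroup.of x) : FreeGroup X ⧸ V)

section SmallIndex

open Equiv
open scoped commutatorElement

universe u

theorem mk_quotient_comap_le {K L : Type u} [Group K] [Group L] (f : K →* L) (H : Subgroup L) :
    #(K ⧸ H.comap f) ≤ #(L ⧸ H) := by
  have hf (a b : K) : QuotientGroup.leftRel (H.comap f) a b ↔
      QuotientGroup.leftRel H (f a) (f b) := by
    simp [QuotientGroup.leftRel_apply]
  refine Cardinal.mk_le_of_injective (f := Quotient.map' f fun a b => (hf a b).1) ?_
  rintro ⟨a⟩ ⟨b⟩ h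
  exact Quotient.sound' ((hf a b).2 (Quotient.exact' h))

/-- A subgroup of index at most `#I` in a power `I → P` projects onto some factor. -/
theorem exists_eval_surjective_of_mk_quotient_le {I P : Type u} [Group P]
    (N : Subgroup (I → P)) (hN : #((I → P) ⧸ N) ≤ #I) :
    ∃ i, ∀ f : P, ∃ s ∈ N, s i = f := by
  classical
  by_contra! h
  choose f hf using h
  obtain ⟨ι⟩ := hN
  let g : Set I → I → P := fun J i => if i ∈ J then f i else 1
  have hsub (J K : Set I) (h : (g J)⁻¹ * g K ∈ N) : K ⊆ J := by
    intro i hK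
    by_contra hJ
    exact hf i _ h (by simp [g, hJ, hK])
  refine Function.cantor_injective (fun J => ι (g J : (I → P) ⧸ N)) fun J K h => ?_
  have h := QuotientGroup.eq.1 (ι.injective h)
  exact (hsub K J (by simpa using N.inv_mem h)).antisymm (hsub J K h)

/-- A subgroup of index at most `#I` in `I → I → Q` contains all commutators of some factor. -/
theorem exists_mulSingle_commutator_mem {I Q : Type u} [Group Q] [DecidableEq I]
    (N : Subgroup (I → I → Q)) (hN : #((I → I → Q) ⧸ N) ≤ #I) :
    ∃ i j, ∀ a b : Q,
      (Pi.mulSingle i (Pi.mulSingle j ⁅a, b⁆ : I → Q) : I → I → Q) ∈ N := by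
  obtain ⟨i, hi⟩ := exists_eval_surjective_of_mk_quotient_le N hN
  obtain ⟨j, hj⟩ := exists_eval_surjective_of_mk_quotient_le
    (N.comap (MonoidHom.mulSingle (fun _ => I → Q) i)) ((mk_quotient_comap_le _ N).trans hN)
  refine ⟨i, j, fun a b => ?_⟩
  obtain ⟨t, htN, rfl⟩ := hj a
  obtain ⟨s, hsN, hs⟩ := hi (Pi.mulSingle j b)
  have htN' : (Pi.mulSingle i t : I → I → Q) ∈ N := htN
  have key : (Pi.mulSingle i (Pi.mulSingle j ⁅t j, b⁆ : I → Q) : I → I → Q) =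
      Pi.mulSingle i t * s * (Pi.mulSingle i t)⁻¹ * s⁻¹ := by
    ext k l
    by_cases hk : k = i
    · subst hk
      by_cases hl : l = j
      · subst hl
        simp [hs, commutatorElement_def]
      · simp [hs, hl]
    · simp [hk]
  rw [key]
  exact N.mul_mem (N.mul_mem (N.mul_mem htN' hsN) (N.inv_mem htN')) (N.inv_mem hsN)

/-- The permutation of `ℤ × X` acting as `g` on the layer `0` and trivially elsewhere is a
commutator: of `g` acting on all nonnegative layers, and the shift. -/
theorem exists_commutator_eq_layer {X : Type u} (g : Perm X) :
    ∃ a b : Perm (ℤ × X), ∀ n x, ⁅a, b⁆ (n, x) = (n, if n = 0 then g x else x) := by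
  let a : Perm (ℤ × X) :=
    { toFun := fun p => (p.1, if 0 ≤ p.1 then g p.2 else p.2)
      invFun := fun p => (p.1, if 0 ≤ p.1 then g⁻¹ p.2 else p.2)
      left_inv := fun p => by by_cases h : 0 ≤ p.1 <;> simp [h]
      right_inv := fun p => by by_cases h : 0 ≤ p.1 <;> simp [h] }
  let b : Perm (ℤ × X) := (Equiv.addRight 1).prodCongr (Equiv.refl X)
  refine ⟨a, b, fun n x => ?_⟩
  have ha (n : ℤ) (x : X) : a (n, x) = (n, if 0 ≤ n then g x else x) := rfl
  have ha' (n : ℤ) (x : X) : a⁻¹ (n, x) = (n, if 0 ≤ n then g⁻¹ x else x) := rfl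
  have hb (n : ℤ) (x : X) : b (n, x) = (n + 1, x) := rfl
  have hb' (n : ℤ) (x : X) : b⁻¹ (n, x) = (n - 1, x) := rfl
  simp only [commutatorElement_def, Perm.mul_apply, ha, ha', hb, hb', sub_add_cancel]
  rcases lt_trichotomy n 0 with h | rfl | h
  · simp [h.not_ge, h.ne, show ¬ 1 ≤ n by omega]
  · simp
  · simp [h.le, h.ne', show 1 ≤ n by omega]

/-- The permutation of `I × J × Z` acting on each fibre over `I × J` as prescribed. -/
def fibrePermHom (I J Z : Type*) : (I → J → Perm Z) →* Perm (I × J × Z) where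
  toFun s :=
    { toFun := fun p => (p.1, p.2.1, s p.1 p.2.1 p.2.2)
      invFun := fun p => (p.1, p.2.1, (s p.1 p.2.1)⁻¹ p.2.2)
      left_inv := fun p => by simp
      right_inv := fun p => by simp }
  map_one' := rfl
  map_mul' _ _ := rfl

theorem mem_fixingSubgroup_compl_iff {X : Type u} {S : Set X} {p : Perm X} :
    p ∈ fixingSubgroup (Perm X) Sᶜ ↔ ∀ x ∉ S, p x = x := by
  simp [mem_fixingSubgroup_iff]

theorem apply_mem_of_mem_fixingSubgroup_compl {X : Type u} {S : Set X} {p : Perm X}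
    (hp : p ∈ fixingSubgroup (Perm X) Sᶜ) {x : X} (hx : x ∈ S) : p x ∈ S := by
  by_contra h
  exact h (by rwa [p.injective (mem_fixingSubgroup_compl_iff.1 hp _ h)])

/-- A subgroup of small index in the symmetric group contains the full symmetric group of
some moiety. -/
theorem exists_moiety_fixingSubgroup_le {X : Type u} [Infinite X] (H : Subgroup (Perm X))
    (hH : #(Perm X ⧸ H) ≤ #X) :
    ∃ S : Set X, #S = #X ∧ #(Sᶜ : Set X) = #X ∧ fixingSubgroup (Perm X) Sᶜ ≤ H := by
  classical
  have hcard : #(X × X × ℤ × X) = #X := by simp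
  obtain ⟨e⟩ := Cardinal.eq.1 hcard
  let Ψ : (X → X → Perm (ℤ × X)) →* Perm X :=
    e.permCongrHom.toMonoidHom.comp (fibrePermHom X X (ℤ × X))
  have hΨ s p : Ψ s (e p) = e (p.1, p.2.1, s p.1 p.2.1 p.2.2) := by
    simp [Ψ, fibrePermHom]
  obtain ⟨i, j, hij⟩ := exists_mulSingle_commutator_mem (H.comap Ψ)
    ((mk_quotient_comap_le Ψ H).trans hH)
  let c (n : ℤ) (x : X) : X := e (i, j, n, x)
  have hc n : Function.Injective (c n) := fun x y h => by simpa [c] using h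
  have hS : ∀ n m x, c n x ∈ Set.range (c m) ↔ n = m := by
    intro n m x
    constructor
    · rintro ⟨y, hy⟩
      simp only [c, EmbeddingLike.apply_eq_iff_eq, Prod.mk.injEq, true_and] at hy
      exact hy.1.symm
    · rintro rfl
      exact ⟨x, rfl⟩
  refine ⟨Set.range (c 0), Cardinal.mk_range_eq _ (hc 0), (Cardinal.mk_set_le _).antisymm ?_, ?_⟩
  · rw [← Cardinal.mk_range_eq _ (hc 1)]
    refine Cardinal.mk_le_mk_of_subset ?_
    rintro _ ⟨x, rfl⟩
    simp [hS]
  · intro p hp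
    have hmem (q : Perm X) (hq : q ∈ fixingSubgroup (Perm X) (Set.range (c 0))ᶜ) (x : X) :
        c 0 (e.symm (q (c 0 x))).2.2.2 = q (c 0 x) := by
      obtain ⟨y, hy⟩ := apply_mem_of_mem_fixingSubgroup_compl hq ⟨x, rfl⟩
      rw [← hy]
      simp [c]
    let g : Perm X :=
      { toFun := fun x => (e.symm (p (c 0 x))).2.2.2
        invFun := fun x => (e.symm (p⁻¹ (c 0 x))).2.2.2
        left_inv := fun x => by beta_reduce; rw [hmem p hp]; simp [c]
        right_inv := fun x => by beta_reduce; rw [hmem p⁻¹ (inv_mem hp)]; simp [c] }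
    have hg x : c 0 (g x) = p (c 0 x) := hmem p hp x
    obtain ⟨a, b, hab⟩ := exists_commutator_eq_layer g
    have key : Ψ (Pi.mulSingle i (Pi.mulSingle j ⁅a, b⁆ : X → Perm (ℤ × X))) = p := by
      ext y
      obtain ⟨⟨k, l, n, x⟩, rfl⟩ := e.surjective y
      rw [hΨ]
      by_cases h : k = i ∧ l = j ∧ n = 0
      · obtain ⟨rfl, rfl, rfl⟩ := h
        simp only [Pi.mulSingle_eq_same, hab, if_true]
        exact hg x
      · have hp' : p (e (k, l, n, x)) = e (k, l, n, x) := by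
          refine mem_fixingSubgroup_compl_iff.1 hp _ ?_
          rintro ⟨y, hy⟩
          simp only [c, EmbeddingLike.apply_eq_iff_eq, Prod.mk.injEq] at hy
          exact h ⟨hy.1.symm, hy.2.1.symm, hy.2.2.1.symm⟩
        rw [hp']
        by_cases hk : k = i
        · subst hk
          by_cases hl : l = j
          · subst hl
            simp only [Pi.mulSingle_eq_same, hab]
            simp_all
          · simp [hl]
        · simp [hk]
    rw [← key]
    exact hij a b

/-- Diagonal argument: with few colours, two functions of the same colour are almost disjoint. -/
theorem exists_eq_and_mk_agree_lt {X Q : Type u} [Infinite X] (hQ : #Q ≤ #X)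
    (φ : (X → X) → Q) :
    ∃ f f', φ f = φ f' ∧ #{x | f x = f' x} < #X := by
  classical
  obtain ⟨_, _, hord⟩ := Cardinal.exists_ord_eq_type_lt X
  obtain ⟨ι⟩ := hQ
  have hlt (x : X) : #(Set.Iio x) < #X := Cardinal.mk_Iio_lt x hord
  have hf (x : X) : ∃ y, ∀ q, ι q < x → y ≠ Function.invFun φ q x := by
    by_contra! h
    choose q hq hy using h
    refine (hlt x).not_ge (Cardinal.mk_le_of_injective (f := fun y => ⟨ι (q y), hq y⟩) ?_)
    intro y z hyz
    have := ι.injective (congrArg Subtype.val hyz)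
    rw [hy y, hy z, this]
  choose f hf using hf
  refine ⟨f, Function.invFun φ (φ f), (Function.invFun_eq ⟨f, rfl⟩).symm, ?_⟩
  refine lt_of_le_of_lt ((Cardinal.mk_le_mk_of_subset
    (t := Set.Iio (ι (φ f)) ∪ {ι (φ f)}) ?_).trans (Cardinal.mk_union_le _ _))
    (Cardinal.add_lt_of_lt (Cardinal.aleph0_le_mk X) (hlt _) ?_)
  · intro x hx
    rcases lt_trichotomy x (ι (φ f)) with h | h | h
    · exact Or.inl h
    · exact Or.inr h
    · exact absurd hx (hf x _ h)
  · rw [Cardinal.mk_singleton]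
    exact Cardinal.one_lt_aleph0.trans_le (Cardinal.aleph0_le_mk X)

theorem exists_disjoint_subsets_mk_eq {X : Type u} {F : Set X} {κ : Cardinal.{u}}
    (hκ : ℵ₀ ≤ κ) (hF : #F = κ) :
    ∃ A ⊆ F, ∃ B ⊆ F, Disjoint A B ∧ #A = κ ∧ #B = κ := by
  obtain ⟨e⟩ : Nonempty (F ⊕ F ≃ F) := Cardinal.eq.1 (by
    simp [hF, Cardinal.add_eq_self hκ])
  refine ⟨Set.range fun x => (e (Sum.inl x) : X), ?_, Set.range fun x => (e (Sum.inr x) : X),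
    ?_, ?_, ?_, ?_⟩
  · rintro _ ⟨x, rfl⟩; exact (e _).2
  · rintro _ ⟨x, rfl⟩; exact (e _).2
  · rw [Set.disjoint_left]
    rintro _ ⟨x, rfl⟩ ⟨y, hy⟩
    simp [Subtype.val_inj] at hy
  · rw [Cardinal.mk_range_eq, hF]
    intro x y h
    simpa [Subtype.val_inj] using h
  · rw [Cardinal.mk_range_eq, hF]
    intro x y h
    simpa [Subtype.val_inj] using h

/-- An injection between subsets of `S` with equinumerous complements in `S` extends to a
permutation supported in `S`. -/
theorem exists_mem_fixingSubgroup_compl_eqOn {X : Type u} {S E : Set X} {m : X → X}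
    (hES : E ⊆ S) (hm : Set.InjOn m E) (hmS : m '' E ⊆ S)
    (hcard : #(S \ E : Set X) = #(S \ m '' E : Set X)) :
    ∃ p ∈ fixingSubgroup (Perm X) Sᶜ, Set.EqOn p m E := by
  classical
  let f : ↥(E ∪ Sᶜ) ↪ X :=
    { toFun := fun x => if (x : X) ∈ E then m x else x
      inj' := by
        rintro ⟨x, hx⟩ ⟨y, hy⟩ h
        have hmx : ∀ {x}, x ∈ E → m x ∈ S := fun h => hmS ⟨_, h, rfl⟩
        simp only [Subtype.mk.injEq]
        by_cases hxE : x ∈ E <;> by_cases hyE : y ∈ E <;>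
          simp only [hxE, hyE, if_true, if_false] at h
        · exact hm hxE hyE h
        · exact absurd (h ▸ hmx hxE) (hy.resolve_left hyE)
        · exact absurd (h ▸ hmx hyE) (hx.resolve_left hxE)
        · exact h }
  have hfE {x} (hx : x ∈ E) : f ⟨x, Or.inl hx⟩ = m x := if_pos hx
  have hfS {x} (hx : x ∉ S) : f ⟨x, Or.inr hx⟩ = x := if_neg fun h => hx (hES h)
  have hrange : Set.range f = m '' E ∪ Sᶜ := by
    ext y
    constructor
    · rintro ⟨⟨x, hx | hx⟩, rfl⟩
      · exact Or.inl ⟨x, hx, (hfE hx).symm⟩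
      · exact Or.inr ((hfS hx).symm ▸ hx)
    · rintro (⟨x, hx, rfl⟩ | hy)
      · exact ⟨_, hfE hx⟩
      · exact ⟨_, hfS hy⟩
  obtain ⟨p, hp⟩ := Cardinal.extend_function f (Cardinal.eq.1 (by
    rw [hrange, Set.compl_union, Set.compl_union, compl_compl, Set.inter_comm, Set.inter_comm _ S]
    exact hcard))
  exact ⟨p, mem_fixingSubgroup_compl_iff.2 fun x hx => (hp ⟨x, Or.inr hx⟩).trans (hfS hx),
    fun x hx => (hp ⟨x, Or.inl hx⟩).trans (hfE hx)⟩

/-- If `S` and `T` meet in a set of full cardinality, the symmetric groups of `S` and `T`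
generate that of `S ∪ T`. -/
theorem fixingSubgroup_compl_union_le {X : Type u} [Infinite X] {S T : Set X}
    {H : Subgroup (Perm X)} (hS : fixingSubgroup (Perm X) Sᶜ ≤ H)
    (hT : fixingSubgroup (Perm X) Tᶜ ≤ H) (hST : #(S ∩ T : Set X) = #X) :
    fixingSubgroup (Perm X) (S ∪ T)ᶜ ≤ H := by
  have hX := Cardinal.aleph0_le_mk X
  have full {A B : Set X} (h : A ⊆ B) (hA : #A = #X) : #B = #X :=
    (Cardinal.mk_set_le _).antisymm (hA ▸ Cardinal.mk_le_mk_of_subset h)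
  intro g hg
  have hgD : ∃ F ⊆ S ∩ T, #F = #X ∧ ∃ R, S ∩ T ⊆ R ∧ R ⊆ S ∪ T ∧
      fixingSubgroup (Perm X) Rᶜ ≤ H ∧ g '' F ⊆ R := by
    by_cases h : #((S ∩ T) ∩ g ⁻¹' S : Set X) = #X
    · exact ⟨_, Set.inter_subset_left, h, S, Set.inter_subset_left, Set.subset_union_left, hS,
        by rintro _ ⟨x, hx, rfl⟩; exact hx.2⟩
    · refine ⟨(S ∩ T) \ g ⁻¹' S, Set.sdiff_subset, ?_, T, Set.inter_subset_right,
        Set.subset_union_right, hT, ?_⟩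
      · by_contra h'
        refine hST.not_lt ?_
        rw [← Set.inter_union_sdiff (S ∩ T) (g ⁻¹' S)]
        exact (Cardinal.mk_union_le _ _).trans_lt (Cardinal.add_lt_of_lt hX
          ((Cardinal.mk_set_le _).lt_of_ne h) ((Cardinal.mk_set_le _).lt_of_ne h'))
      · rintro _ ⟨x, hx, rfl⟩
        exact (apply_mem_of_mem_fixingSubgroup_compl hg (Or.inl hx.1.1)).resolve_left hx.2
  obtain ⟨F, hFD, hF, R, hDR, hRST, hR, hgF⟩ := hgD
  obtain ⟨E, hEF, E', hE'F, hEE', hE, hE'⟩ := exists_disjoint_subsets_mk_eq hX hF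
  have himage (A : Set X) : #(g '' A) = #A := Cardinal.mk_image_eq g.injective
  obtain ⟨s, hs, hsE⟩ := exists_mem_fixingSubgroup_compl_eqOn (S := R) (E := E) (m := g)
    ((hEF.trans hFD).trans hDR) g.injective.injOn ((Set.image_mono hEF).trans hgF) (by
      rw [full (A := E') (B := R \ E)
          (fun x hx => ⟨hDR (hFD (hE'F hx)), fun h => hEE'.ne_of_mem h hx rfl⟩) hE',
        full (A := g '' E') _ ((himage _).trans hE')]
      rintro _ ⟨x, hx, rfl⟩
      refine ⟨hgF ⟨x, hE'F hx, rfl⟩, ?_⟩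
      rintro ⟨y, hy, hyx⟩
      exact hEE'.ne_of_mem hy hx (g.injective hyx))
  obtain ⟨A, hAE, A', hA'E, hAA', hA, hA'⟩ := exists_disjoint_subsets_mk_eq hX hE
  obtain ⟨m⟩ : #(T \ S : Set X) ≤ #A := hA ▸ Cardinal.mk_set_le _
  classical
  let m' : X → X := fun x => if hx : x ∈ T \ S then m ⟨x, hx⟩ else x
  have hm'A : m' '' (T \ S) ⊆ A := by
    rintro _ ⟨x, hx, rfl⟩
    simp only [m', dif_pos hx]
    exact (m _).2
  have hET : E ⊆ T := fun x hx => (hFD (hEF hx)).2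
  have hES : E ⊆ S := fun x hx => (hFD (hEF hx)).1
  obtain ⟨k, hk, hkm⟩ := exists_mem_fixingSubgroup_compl_eqOn (S := T) (E := T \ S) (m := m')
    Set.sdiff_subset (fun x hx y hy h => by
      simp only [m', dif_pos hx, dif_pos hy] at h
      simpa using m.injective (Subtype.val_injective h))
    ((hm'A.trans hAE).trans hET) (by
      rw [full (A := E) (B := T \ (T \ S)) (fun x hx => ⟨hET hx, fun h => h.2 (hES hx)⟩) hE,
        full (A := A') (B := T \ m' '' (T \ S)) (fun x hx => ⟨hET (hA'E hx),
          fun h => hAA'.ne_of_mem (hm'A h) hx rfl⟩) hA'])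
  have hsH := hR hs
  have hkH := hT hk
  have hfix : k⁻¹ * (s⁻¹ * g) * k ∈ fixingSubgroup (Perm X) Sᶜ := by
    refine mem_fixingSubgroup_compl_iff.2 fun x hx => ?_
    have hkx : s (k x) = g (k x) := by
      by_cases hxT : x ∈ T
      · refine hsE (hkm ⟨hxT, hx⟩ ▸ hAE (hm'A ⟨x, ⟨hxT, hx⟩, rfl⟩))
      · have hxST : x ∉ S ∪ T := by simp [hx, hxT]
        rw [mem_fixingSubgroup_compl_iff.1 hk x hxT, mem_fixingSubgroup_compl_iff.1 hg x hxST,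
          mem_fixingSubgroup_compl_iff.1 hs x fun h => hxST (hRST h)]
    simp [Perm.mul_apply, ← hkx]
  have := H.mul_mem hsH (H.mul_mem (H.mul_mem hkH (hS hfix)) (H.inv_mem hkH))
  simpa [mul_assoc] using this

/-- A subgroup of the symmetric group of `X` of index at most `#X` contains the pointwise
stabilizer of a set of fewer than `#X` points. -/
theorem exists_fixingSubgroup_le_of_mk_quotient_le {X : Type u} [Infinite X]
    (H : Subgroup (Perm X)) (hH : #(Perm X ⧸ H) ≤ #X) :
    ∃ D : Set X, #D < #X ∧ fixingSubgroup (Perm X) D ≤ H := by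
  obtain ⟨S, hS, hS', hSH⟩ := exists_moiety_fixingSubgroup_le H hH
  have hX := Cardinal.aleph0_le_mk X
  obtain ⟨e⟩ : Nonempty (X ≃ X × X) := Cardinal.eq.1 (by simp)
  have avoid (a b : X) : ∃ c, c ≠ a ∧ c ≠ b := by
    classical
    obtain ⟨c, hc⟩ := Infinite.exists_notMem_finset ({a, b} : Finset X)
    exact ⟨c, by simpa using hc⟩
  have large (f f' : X → X) : #{x | (e x).2 ≠ f (e x).1 ∧ (e x).2 ≠ f' (e x).1} = #X := by
    refine (Cardinal.mk_set_le _).antisymm ?_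
    choose c hc using avoid
    refine Cardinal.mk_le_of_injective
      (f := fun x => ⟨e.symm (x, c (f x) (f' x)), by simp [hc]⟩) fun x y h => ?_
    simp at h
    exact h.1
  have graph (f : X → X) : ∃ p : Perm X, ∀ x, x ∉ S ↔ (e (p x)).2 = f (e (p x)).1 := by
    obtain ⟨a⟩ : Nonempty (S ≃ {x | (e x).2 ≠ f (e x).1}) :=
      Cardinal.eq.1 (hS.trans (by simpa using (large f f).symm))
    obtain ⟨b⟩ : Nonempty ((Sᶜ : Set X) ≃ ({x | (e x).2 ≠ f (e x).1}ᶜ : Set X)) := by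
      refine Cardinal.eq.1 (hS'.trans ((Cardinal.mk_set_le _).antisymm' ?_))
      exact Cardinal.mk_le_of_injective
        (f := fun x => ⟨e.symm (x, f x), by simp⟩) fun x y h => by
          simp only [Subtype.mk.injEq, EmbeddingLike.apply_eq_iff_eq, Prod.mk.injEq] at h
          exact h.1
    classical
    refine ⟨(Set.sumCompl S).symm.trans ((sumCongr a b).trans (Set.sumCompl _)), fun x => ?_⟩
    by_cases hx : x ∈ S
    · have := (a ⟨x, hx⟩).2
      simp [Set.sumCompl_symm_apply_of_mem, hx]
      exact this
    · have := (b ⟨x, hx⟩).2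
      simp only [Set.mem_compl_iff, Set.mem_ofPred_eq, not_not] at this
      simpa [Set.sumCompl_symm_apply_of_notMem, hx] using this
  choose p hp using graph
  obtain ⟨f, f', hff', hlt⟩ := exists_eq_and_mk_agree_lt hH fun f => (p f : Perm X ⧸ H)
  have hh : (p f)⁻¹ * p f' ∈ H := QuotientGroup.eq.1 hff'
  set h := (p f)⁻¹ * p f' with hdef
  let T : Set X := {x | h⁻¹ x ∈ S}
  have hTx (x : X) : x ∉ T ↔ (e (p f x)).2 = f' (e (p f x)).1 := by
    simpa [T, hdef] using hp f' (h⁻¹ x)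
  have hTH : fixingSubgroup (Perm X) Tᶜ ≤ H := by
    intro q hq
    have hq' : h⁻¹ * q * h ∈ fixingSubgroup (Perm X) Sᶜ := by
      refine mem_fixingSubgroup_compl_iff.2 fun x hx => ?_
      have : q (h x) = h x := mem_fixingSubgroup_compl_iff.1 hq _ (by simpa [T] using hx)
      rw [Perm.mul_apply, Perm.mul_apply, this]
      exact h.symm_apply_apply x
    have := H.mul_mem (H.mul_mem hh (hSH hq')) (H.inv_mem hh)
    simpa [mul_assoc] using this
  refine ⟨(S ∪ T)ᶜ, ?_, fixingSubgroup_compl_union_le hSH hTH ?_⟩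
  · refine lt_of_le_of_lt (Cardinal.mk_le_of_injective
      (f := fun x : ↥(S ∪ T)ᶜ => (⟨(e (p f x)).1, ?_⟩ : {x | f x = f' x})) ?_) hlt
    · obtain ⟨h₁, h₂⟩ := not_or.1 x.2
      exact ((hp f x).1 h₁).symm.trans ((hTx x).1 h₂)
    · intro x y hxy
      have hx := (hp f x).1 (not_or.1 x.2).1
      have hy := (hp f y).1 (not_or.1 y.2).1
      have h₁ : (e (p f x)).1 = (e (p f y)).1 := congrArg Subtype.val hxy
      exact Subtype.ext ((p f).injective (e.injective (Prod.ext h₁ (by rw [hx, hy, h₁]))))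
  · rw [← large f f']
    refine Cardinal.mk_congr ((p f).subtypeEquiv fun x => ?_)
    exact and_congr (not_not.symm.trans (hp f x).not) (not_not.symm.trans (hTx x).not)

/-- The action of permutations of the generators on a quotient of a free group by a fully
invariant subgroup. -/
def permQuotientHom {X : Type u} (V : Subgroup (FreeGroup X)) [V.Normal]
    (hV : ∀ f : FreeGroup X →* FreeGroup X, V.map f ≤ V) :
    Perm X →* MulAut (FreeGroup X ⧸ V) where
  toFun e := QuotientGroup.congr V V (FreeGroup.freeGroupCongr e) <| by
    refine (hV _).antisymm fun x hx => ?_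
    refine ⟨(FreeGroup.freeGroupCongr e).symm x, ?_, MulEquiv.apply_symm_apply _ x⟩
    exact hV ((FreeGroup.freeGroupCongr e).symm : FreeGroup X →* FreeGroup X) ⟨x, hx, rfl⟩
  map_one' := by
    ext x
    obtain ⟨x, rfl⟩ := QuotientGroup.mk_surjective x
    simp
  map_mul' a b := by
    ext x
    obtain ⟨x, rfl⟩ := QuotientGroup.mk_surjective x
    simp [FreeGroup.map.comp]

theorem permQuotientHom_mk_of {X : Type u} (V : Subgroup (FreeGroup X)) [V.Normal]
    (hV : ∀ f : FreeGroup X →* FreeGroup X, V.map f ≤ V) (e : Perm X) (x : X) :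
    permQuotientHom V hV e (FreeGroup.of x : FreeGroup X) = (FreeGroup.of (e x) : FreeGroup X) := by
  simp [permQuotientHom]

theorem mulAut_eq_of_eqOn_generators {X : Type u} {V : Subgroup (FreeGroup X)} [V.Normal]
    {φ ψ : MulAut (FreeGroup X ⧸ V)}
    (h : ∀ x, φ (FreeGroup.of x : FreeGroup X) = ψ (FreeGroup.of x : FreeGroup X)) : φ = ψ := by
  have : (φ : FreeGroup X ⧸ V →* FreeGroup X ⧸ V) = ψ := by
    ext x
    exact h x
  exact MulEquiv.toMonoidHom_injective this

/-- If two generators become equal modulo a fully invariant subgroup, then all become trivial. -/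
theorem of_mem_of_mk_of_eq {X : Type u} {V : Subgroup (FreeGroup X)}
    (hV : ∀ f : FreeGroup X →* FreeGroup X, V.map f ≤ V) {a b : X} (hab : a ≠ b)
    (h : (QuotientGroup.mk (FreeGroup.of a) : FreeGroup X ⧸ V) =
      QuotientGroup.mk (FreeGroup.of b)) (x : X) : FreeGroup.of x ∈ V := by
  classical
  have := hV (FreeGroup.lift fun y => if y = b then FreeGroup.of x else 1)
    ⟨_, QuotientGroup.eq.1 h, rfl⟩
  simpa [hab] using this

end SmallIndex

/-- If `G = FreeGroup X ⧸ V` is a relatively free group of infinite rank `κ = #X`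
(`V` fully invariant) and `Σ` is a subgroup of `Γ = Aut G` with `|Γ/Σ| ≤ κ`, then there
is a subset `U` of the basis `X̄` with `#U < κ` such that every permutational
automorphism of `G` w.r.t. `X̄` fixing `U` pointwise lies in `Σ`. -/
theorem small_index_subgroup_contains_pointwise_stabilizer
    {X : Type*} [Infinite X] (V : Subgroup (FreeGroup X)) [V.Normal]
    (hV : ∀ f : FreeGroup X →* FreeGroup X, V.map f ≤ V)
    (Sg : Subgroup (MulAut (FreeGroup X ⧸ V)))
    (hSg : Cardinal.mk (MulAut (FreeGroup X ⧸ V) ⧸ Sg) ≤ Cardinal.mk X) :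
    ∃ U : Set (FreeGroup X ⧸ V),
      U ⊆ genBasis V ∧
      Cardinal.mk U < Cardinal.mk X ∧
      ∀ φ : MulAut (FreeGroup X ⧸ V),
        (∃ e : Equiv.Perm X, ∀ x : X,
            φ (QuotientGroup.mk (FreeGroup.of x)) = QuotientGroup.mk (FreeGroup.of (e x))) →
        (∀ u ∈ U, φ u = u) →
        φ ∈ Sg := by
  obtain ⟨D, hD, hDH⟩ := exists_fixingSubgroup_le_of_mk_quotient_le
    (Sg.comap (permQuotientHom V hV)) ((mk_quotient_comap_le _ Sg).trans hSg)
  refine ⟨(fun x : X => (QuotientGroup.mk (FreeGroup.of x) : FreeGroup X ⧸ V)) '' D,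
    Set.image_subset_range _ _, Cardinal.mk_image_le.trans_lt hD, ?_⟩
  rintro φ ⟨e, he⟩ hφ
  have hφe : φ = permQuotientHom V hV e := mulAut_eq_of_eqOn_generators fun x => by
    rw [he, permQuotientHom_mk_of]
  by_cases hfix : ∀ x ∈ D, e x = x
  · rw [hφe]
    exact hDH ((mem_fixingSubgroup_iff _).2 hfix)
  · push Not at hfix
    obtain ⟨x, hxD, hx⟩ := hfix
    have htriv := of_mem_of_mk_of_eq hV hx ((he x).symm.trans (hφ _ ⟨x, hxD, rfl⟩))
    have hφ1 : φ = 1 := mulAut_eq_of_eqOn_generators fun y => by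
      rw [(QuotientGroup.eq_one_iff _).2 (htriv y), map_one, map_one]
    rw [hφ1]
    exact Sg.one_mem
end

section
/- Let G be a relatively free group of infinite rank κ, formalized as G = FreeGroup X ⧸ V with X infinite and V fully invariant, let X̄ be the basis of G given by the images of the generators, let Γ = Aut G, and let Σ be a subgroup of Γ such that the cardinality of the coset space Γ/Σ is at most κ = #X. Then there is a subset U of X̄ of cardinality strictly less than κ such that for every moiety Z of X̄ ∖ U, Σ contains every automorphism of G that fixes X̄ ∖ Z pointwise and maps the subgroup ⟨Z⟩ generated by Z onto itself. -/
open Cardinal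

section Combinatorics

universe u

theorem exists_linearOrder_mk_Iio_lt (α : Type u) :
    ∃ (_ : LinearOrder α) (_ : WellFoundedLT α), ∀ a : α, #(Set.Iio a) < #α := by
  obtain ⟨l, w, h⟩ := Cardinal.exists_ord_eq_type_lt α
  exact ⟨l, w, fun a => Cardinal.mk_Iio_lt a h⟩

theorem mk_lt_of_subset_union {α : Type u} [Infinite α] {A B C : Set α}
    (h : A ⊆ B ∪ C) (hB : #B < #α) (hC : #C < #α) : #A < #α :=
  (Cardinal.mk_le_mk_of_subset h).trans_lt ((Cardinal.mk_union_le B C).trans_lt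
    (Cardinal.add_lt_of_lt (Cardinal.aleph0_le_mk α) hB hC))

/-- An injective choice function avoiding small forbidden sets. -/
theorem exists_injective_avoiding {ι Y : Type u} [Infinite Y] (hι : #ι ≤ #Y) (S : Set Y)
    (hS : #S = #Y) (T : ι → Set Y) (hT : ∀ i, #(T i) < #Y) :
    ∃ f : ι → Y, Function.Injective f ∧ ∀ i, f i ∈ S ∧ f i ∉ T i := by
  obtain ⟨_, hw, hlt⟩ := exists_linearOrder_mk_Iio_lt ι
  have key : ∀ (i : ι) (g : (j : ι) → j < i → Y),
      ∃ y, y ∈ S ∧ y ∉ T i ∧ ∀ j (hj : j < i), y ≠ g j hj := by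
    intro i g
    by_contra! hcon
    have hsub : S ⊆ T i ∪ Set.range (fun j : Set.Iio i => g j.1 j.2) := by
      intro y hy
      by_cases hyT : y ∈ T i
      · exact Or.inl hyT
      · obtain ⟨j, hj, rfl⟩ := hcon y hy hyT
        exact Or.inr ⟨⟨j, hj⟩, rfl⟩
    exact (mk_lt_of_subset_union hsub (hT i)
      (Cardinal.mk_range_le.trans_lt ((hlt i).trans_le hι))).ne hS
  choose F hF using key
  let f : ι → Y := hw.wf.fix F
  have hf : ∀ i, f i = F i (fun j _ => f j) := fun i => hw.wf.fix_eq F i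
  have hlt' : ∀ i j, j < i → f i ≠ f j := by
    intro i j hj
    rw [hf i]
    exact (hF i _).2.2 j hj
  refine ⟨f, fun i j hij => ?_, fun i => ?_⟩
  · rcases lt_trichotomy i j with h | h | h
    · exact absurd hij.symm (hlt' j i h)
    · exact h
    · exact absurd hij (hlt' i j h)
  · rw [hf i]
    exact ⟨(hF i _).1, (hF i _).2.1⟩

/-- A family of more than `#Y` functions `Y → Y`, any two of which agree on fewer than `#Y`
points. -/
theorem exists_eventually_different_family (Y : Type u) [Infinite Y] :
    ∃ 𝒜 : Set (Y → Y), #Y < #𝒜 ∧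
      ∀ f ∈ 𝒜, ∀ g ∈ 𝒜, f ≠ g → #{y | f y = g y} < #Y := by
  let P : Set (Set (Y → Y)) := {𝒜 | 𝒜.Pairwise fun f g => #{y | f y = g y} < #Y}
  obtain ⟨𝒜, h𝒜⟩ : ∃ 𝒜, Maximal (fun x => x ∈ P) 𝒜 := by
    refine zorn_subset P fun c hc hch => ⟨⋃₀ c, ?_, fun s hs => Set.subset_sUnion_of_mem hs⟩
    exact (Set.pairwise_sUnion hch.directedOn).2 hc
  refine ⟨𝒜, ?_, fun f hf g hg hfg => h𝒜.prop hf hg hfg⟩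
  by_contra! hle
  obtain ⟨_, hw, hlt⟩ := exists_linearOrder_mk_Iio_lt Y
  obtain ⟨a⟩ := (Cardinal.le_def _ _).1 hle
  have hg : ∀ y : Y, ∃ z, ∀ f : 𝒜, a f < y → z ≠ f.1 y := by
    intro y
    by_contra! hcon
    choose k hk hk' using hcon
    have hinj : Function.Injective fun z => (⟨a (k z), hk z⟩ : Set.Iio y) := by
      intro z z' h
      have : k z = k z' := a.injective (congrArg Subtype.val h)
      rw [hk' z, hk' z', this]
    exact (Cardinal.mk_le_of_injective hinj).not_gt (hlt y)
  choose g hg using hg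
  have hsmall : ∀ f ∈ 𝒜, #{y | g y = f y} < #Y := by
    intro f hf
    have hsub : {y | g y = f y} ⊆ Set.Iio (a ⟨f, hf⟩) ∪ {a ⟨f, hf⟩} := by
      intro y hy
      by_contra hy'
      have : a ⟨f, hf⟩ < y := by
        simp only [Set.mem_union, Set.mem_Iio, Set.mem_singleton_iff, not_or, not_lt] at hy'
        exact lt_of_le_of_ne hy'.1 (Ne.symm hy'.2)
      exact hg y ⟨f, hf⟩ this hy
    refine mk_lt_of_subset_union hsub (hlt _) ?_
    rw [Cardinal.mk_singleton]
    exact Cardinal.one_lt_aleph0.trans_le (Cardinal.aleph0_le_mk Y)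
  have hmem : g ∈ 𝒜 := by
    have : insert g 𝒜 ∈ P := by
      refine h𝒜.prop.insert fun f hf _ => ⟨hsmall f hf, ?_⟩
      simpa only [eq_comm] using hsmall f hf
    exact h𝒜.le_of_ge this (Set.subset_insert g 𝒜) (Set.mem_insert g 𝒜)
  have := hsmall g hmem
  simp at this

theorem exists_maximal_disjoint_family {Y : Type u} (p : Set Y → Prop) (hp : ¬ p ∅) :
    ∃ F : Set (Set Y), (∀ A ∈ F, p A) ∧ F.Pairwise Disjoint ∧
      ∀ A, p A → ¬ Disjoint A (⋃₀ F) := by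
  let P : Set (Set (Set Y)) := {F | (∀ A ∈ F, p A) ∧ F.Pairwise Disjoint}
  obtain ⟨F, hF⟩ : ∃ F, Maximal (fun x => x ∈ P) F := by
    refine zorn_subset P fun c hc hch => ⟨⋃₀ c, ⟨?_, ?_⟩, fun s hs => Set.subset_sUnion_of_mem hs⟩
    · rintro A ⟨s, hs, hA⟩
      exact (hc hs).1 A hA
    · exact (Set.pairwise_sUnion hch.directedOn).2 fun s hs => (hc hs).2
  refine ⟨F, hF.prop.1, hF.prop.2, fun A hA hdis => ?_⟩
  have hmem : A ∈ F := by
    have : insert A F ∈ P := by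
      refine ⟨?_, hF.prop.2.insert fun B hB _ => ?_⟩
      · rintro B (rfl | hB)
        · exact hA
        · exact hF.prop.1 B hB
      · have := hdis.mono_right (Set.subset_sUnion_of_mem hB)
        exact ⟨this, this.symm⟩
    exact hF.le_of_ge this (Set.subset_insert A F) (Set.mem_insert A F)
  have : A = ∅ := disjoint_self.1 (hdis.mono_right (Set.subset_sUnion_of_mem hmem))
  exact hp (this ▸ hA)

theorem exists_moiety (Y : Type u) [Infinite Y] : ∃ S : Set Y, #S = #Y ∧ #(Sᶜ : Set Y) = #Y := by
  obtain ⟨e⟩ : Nonempty (Y ⊕ Y ≃ Y) := by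
    rw [← Cardinal.eq]
    simp
  refine ⟨Set.range (e ∘ Sum.inl), Cardinal.mk_range_eq _ (e.injective.comp Sum.inl_injective), ?_⟩
  refine le_antisymm (Cardinal.mk_set_le _) ?_
  rw [← Cardinal.mk_range_eq (e ∘ Sum.inr) (e.injective.comp Sum.inr_injective)]
  refine Cardinal.mk_le_mk_of_subset ?_
  rintro _ ⟨y, rfl⟩ ⟨z, hz⟩
  simp at hz

theorem exists_perm_extending {α : Type u} {A : Set α} (f : A → α) (hf : Function.Injective f)
    (hA : #(Aᶜ : Set α) = #α) (hfA : #((Set.range f)ᶜ : Set α) = #α) :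
    ∃ π : Equiv.Perm α, ∀ x : A, π x = f x :=
  Cardinal.extend_function ⟨f, hf⟩ (Cardinal.eq.1 (hA.trans hfA.symm))

theorem exists_perm_image_eq {α : Type u} {A B : Set α} (h : #A = #B)
    (h' : #(Aᶜ : Set α) = #(Bᶜ : Set α)) : ∃ π : Equiv.Perm α, π '' A = B := by
  obtain ⟨e⟩ := Cardinal.eq.1 h
  obtain ⟨π, hπ⟩ := Cardinal.extend_function (e.toEmbedding.trans (Function.Embedding.subtype _))
    (by
      rw [← Cardinal.eq, h']
      congr
      ext x
      simp [Function.Embedding.trans])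
  refine ⟨π, ?_⟩
  ext y
  constructor
  · rintro ⟨x, hx, rfl⟩
    rw [hπ ⟨x, hx⟩]
    exact (e ⟨x, hx⟩).2
  · intro hy
    refine ⟨e.symm ⟨y, hy⟩, (e.symm ⟨y, hy⟩).2, ?_⟩
    rw [hπ (e.symm ⟨y, hy⟩)]
    simp

end Combinatorics

section SmallIndexIdeal

universe u

/-- An ideal of subsets of `Y` having at most `#Y` cosets in the Boolean ring `Set Y`, and whose
stabilizer has at most `#Y` cosets in `Equiv.Perm Y`. -/
structure SmallIndexIdeal {Y : Type u} (E : Set (Set Y)) : Prop where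
  empty : ∅ ∈ E
  subset : ∀ A ∈ E, ∀ B ⊆ A, B ∈ E
  union : ∀ A ∈ E, ∀ B ∈ E, A ∪ B ∈ E
  exists_set_coloring : ∃ e : Set Y → Y, ∀ A B, e A = e B → A \ B ∈ E
  exists_perm_coloring : ∃ c : Equiv.Perm Y → Y, ∀ π π', c π = c π' →
    ∀ A ∈ E, ⇑(π⁻¹ * π') '' A ∈ E

namespace SmallIndexIdeal

variable {Y : Type u} {E : Set (Set Y)}

theorem mk_disjoint_family_lt (hE : SmallIndexIdeal E) {F : Set (Set Y)}
    (hF : F.Pairwise Disjoint) (hFE : ∀ A ∈ F, A ∉ E) : #F < #Y := by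
  by_contra! hle
  obtain ⟨e, he⟩ := hE.exists_set_coloring
  let u : Set F → Set Y := fun J => ⋃ A ∈ J, A.1
  have hu : ∀ J J' : Set F, e (u J) = e (u J') → J ⊆ J' := by
    intro J J' h A hA
    by_contra hA'
    refine hFE A.1 A.2 (hE.subset _ (he _ _ h) _ fun y hy => ⟨?_, ?_⟩)
    · exact Set.mem_biUnion hA hy
    · intro hy'
      obtain ⟨B, hB, hyB⟩ := Set.mem_iUnion₂.1 hy'
      have hne : A.1 ≠ B.1 := fun h => hA' (Subtype.ext h ▸ hB)
      exact Set.disjoint_left.1 (hF A.2 B.2 hne) hy hyB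
  have hinj : Function.Injective fun J => e (u J) := fun J J' h =>
    (hu J J' h).antisymm (hu J' J h.symm)
  have := Cardinal.mk_le_of_injective hinj
  rw [Cardinal.mk_set] at this
  exact (this.trans hle).not_gt (Cardinal.cantor _)

variable [Infinite Y]

theorem exists_avoiding_of_le (hE : SmallIndexIdeal E) {μ : Cardinal.{u}} (hμ : μ < #Y) :
    ∃ U : Set Y, #U < #Y ∧ ∀ A : Set Y, #A ≤ μ → Disjoint A U → A ∈ E := by
  obtain ⟨F, hF, hdis, hmax⟩ := exists_maximal_disjoint_family
    (fun A : Set Y => #A ≤ μ ∧ A ∉ E) (fun h => h.2 hE.empty)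
  refine ⟨⋃₀ F, ?_, fun A hA hAF => ?_⟩
  · refine (Cardinal.mk_sUnion_le F).trans_lt ?_
    refine Cardinal.mul_lt_of_lt (Cardinal.aleph0_le_mk Y)
      (hE.mk_disjoint_family_lt hdis fun A hA => (hF A hA).2) ?_
    exact (ciSup_le' fun A : F => (hF A.1 A.2).1).trans_lt hμ
  · by_contra hAE
    exact hmax A ⟨hA, hAE⟩ hAF

theorem exists_avoiding_of_mk_compl (hE : SmallIndexIdeal E) (Y₁ : Set Y)
    (hY₁ : #(Y₁ᶜ : Set Y) = #Y) :
    ∃ U : Set Y, #U < #Y ∧ ∀ A ⊆ Y₁, #A < #Y → Disjoint A U → A ∈ E := by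
  obtain ⟨F, hF, hdis, hmax⟩ := exists_maximal_disjoint_family
    (fun A : Set Y => A ⊆ Y₁ ∧ #A < #Y ∧ A ∉ E) (fun h => h.2.2 hE.empty)
  refine ⟨⋃₀ F, ?_, fun A hA hA' hAF => by_contra fun hAE => hmax A ⟨hA, hA', hAE⟩ hAF⟩
  by_contra! hle
  obtain ⟨c, hc⟩ := hE.exists_perm_coloring
  choose V hV hVE using fun μ : {μ : Cardinal.{u} // μ < #Y} => hE.exists_avoiding_of_le μ.2
  obtain ⟨q', hq'⟩ := (Cardinal.le_def _ _).1 hle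
  let q : ⋃₀ F → Y := Function.invFun q'
  have hq : Function.Surjective q := Function.invFun_surjective hq'
  let rep : Y → Equiv.Perm Y := Function.invFun c
  have hrep : ∀ π, c (rep (c π)) = c π := fun π => Function.invFun_eq ⟨π, rfl⟩
  choose s hsF hs using fun u : ⋃₀ F => u.2
  let T : Set Y → Set Y := fun A => if h : #A < #Y then
    ⋃ u : {u : ⋃₀ F // s u = A}, rep (q u) '' V ⟨#A, h⟩ else ∅
  have hfib : ∀ A : Set Y, #{u : ⋃₀ F // s u = A} ≤ #A := by
    intro A
    refine Cardinal.mk_le_of_injective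
        (f := fun u => (⟨u.1.1, by simpa only [u.2] using hs u.1⟩ : A)) ?_
    intro u u' h
    exact Subtype.ext (Subtype.ext (Subtype.mk.inj h))
  have hT : ∀ A, #(T A) < #Y := by
    intro A
    simp only [T]
    split_ifs with h
    · refine (Cardinal.mk_iUnion_le _).trans_lt ?_
      refine Cardinal.mul_lt_of_lt (Cardinal.aleph0_le_mk Y) ((hfib A).trans_lt h) ?_
      exact (ciSup_le' fun u => Cardinal.mk_image_le).trans_lt (hV ⟨#A, h⟩)
    · rw [Cardinal.mk_eq_zero]
      exact Cardinal.aleph0_pos.trans_le (Cardinal.aleph0_le_mk Y)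
  obtain ⟨f, hf, hfT⟩ := exists_injective_avoiding (Cardinal.mk_set_le (⋃₀ F)) Y₁ᶜ hY₁
    (fun u => T (s u)) fun u => hT _
  have hFY : ⋃₀ F ⊆ Y₁ := Set.sUnion_subset fun A hA => (hF A hA).1
  obtain ⟨π, hπ⟩ := exists_perm_extending f hf
    (le_antisymm (Cardinal.mk_set_le _)
      (hY₁ ▸ Cardinal.mk_le_mk_of_subset (Set.compl_subset_compl.2 hFY)))
    (le_antisymm (Cardinal.mk_set_le _) (hle.trans (Cardinal.mk_le_mk_of_subset fun y hy => by
      rintro ⟨u, rfl⟩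
      exact (hfT u).1 (hFY hy))))
  obtain ⟨u, hu⟩ := hq (c π)
  have hA := hF (s u) (hsF u)
  have hkA : ⇑((rep (c π))⁻¹ * π) '' s u ∉ E := by
    intro h
    have := hc π (rep (c π)) (hrep π).symm _ h
    rw [← Set.image_comp, ← Equiv.Perm.coe_mul] at this
    simp only [mul_assoc, mul_inv_cancel_left, inv_mul_cancel, Equiv.Perm.coe_one,
      Set.image_id] at this
    exact hA.2.2 this
  refine hkA (hVE ⟨#(s u), hA.2.1⟩ _ Cardinal.mk_image_le (Set.disjoint_left.2 ?_))
  rintro _ ⟨y, hy, rfl⟩ hyV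
  let y' : ⋃₀ F := ⟨y, s u, hsF u, hy⟩
  have hsy : s y' = s u := by
    by_contra hne
    exact Set.disjoint_left.1 (hdis (hsF y') (hsF u) hne) (hs y') hy
  refine (hfT y').2 ?_
  simp only [T]
  rw [hsy, dif_pos hA.2.1]
  refine Set.mem_iUnion.2 ⟨⟨u, rfl⟩, _, hyV, ?_⟩
  rw [← hπ y', hu]
  simp [y']

theorem exists_avoiding_of_mk_lt (hE : SmallIndexIdeal E) :
    ∃ U : Set Y, #U < #Y ∧ ∀ A : Set Y, #A < #Y → Disjoint A U → A ∈ E := by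
  obtain ⟨S, hS, hS'⟩ := exists_moiety Y
  obtain ⟨U₁, hU₁, h₁⟩ := hE.exists_avoiding_of_mk_compl S hS'
  obtain ⟨U₂, hU₂, h₂⟩ := hE.exists_avoiding_of_mk_compl Sᶜ (by rwa [compl_compl])
  refine ⟨U₁ ∪ U₂, mk_lt_of_subset_union subset_rfl hU₁ hU₂, fun A hA hAU => ?_⟩
  rw [Set.disjoint_union_right] at hAU
  rw [← Set.inter_union_compl A S]
  exact hE.union _ (h₁ _ Set.inter_subset_right
      ((Cardinal.mk_le_mk_of_subset Set.inter_subset_left).trans_lt hA)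
      (hAU.1.mono_left Set.inter_subset_left)) _
    (h₂ _ Set.inter_subset_right
      ((Cardinal.mk_le_mk_of_subset Set.inter_subset_left).trans_lt hA)
      (hAU.2.mono_left Set.inter_subset_left))

theorem mem_of_forall_mk_lt (hE : SmallIndexIdeal E) {M : Set Y} (hM' : #(Mᶜ : Set Y) = #Y)
    (hsmall : ∀ A ⊆ M, #A < #Y → A ∈ E) : M ∈ E := by
  by_contra hME
  have hM : #M = #Y := by
    by_contra hne
    exact hME (hsmall M subset_rfl (lt_of_le_of_ne (Cardinal.mk_set_le M) hne))
  obtain ⟨𝒜, h𝒜, had⟩ := exists_eventually_different_family Y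
  obtain ⟨p⟩ : Nonempty (Y × Y ≃ Y) := by
    rw [← Cardinal.eq]
    simp
  obtain ⟨c, hc⟩ := hE.exists_perm_coloring
  obtain ⟨e, he⟩ := hE.exists_set_coloring
  let graph : (Y → Y) → Set Y := fun f => Set.range fun y => p (y, f y)
  have hgraph : ∀ f, #(graph f) = #Y := fun f =>
    Cardinal.mk_range_eq _ fun y y' h => congrArg Prod.fst (p.injective h)
  have hgraph' : ∀ f, #((graph f)ᶜ : Set Y) = #Y := by
    intro f
    refine le_antisymm (Cardinal.mk_set_le _) ?_
    choose g hg using fun y => exists_ne (f y)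
    rw [← hgraph g]
    refine Cardinal.mk_le_mk_of_subset ?_
    rintro _ ⟨y, rfl⟩ ⟨y', h⟩
    obtain ⟨rfl, h⟩ := Prod.mk.inj (p.injective h)
    exact hg _ h.symm
  choose π hπ using fun f => exists_perm_image_eq (hM.trans (hgraph f).symm)
    (hM'.trans (hgraph' f).symm)
  let rep : Y → Equiv.Perm Y := Function.invFun c
  have hrep : ∀ π, c (rep (c π)) = c π := fun π => Function.invFun_eq ⟨π, rfl⟩
  let color : 𝒜 → Y := fun f =>
    p (c (π f), e (⇑(rep (c (π f)))⁻¹ '' graph f))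
  have hninj : ¬ Function.Injective color := fun h => (Cardinal.mk_le_of_injective h).not_gt h𝒜
  obtain ⟨f, g, hfg, hne⟩ : ∃ f g, color f = color g ∧ f ≠ g := by
    simpa [Function.Injective] using hninj
  obtain ⟨hcfg, hefg⟩ := Prod.mk.inj (p.injective hfg)
  have hdiff := he _ _ hefg
  rw [← hcfg, ← Set.image_sdiff (Equiv.injective _)] at hdiff
  have hdiff' := hc (π f) (rep (c (π f))) (hrep _).symm _ hdiff
  rw [← Set.image_comp, ← Equiv.Perm.coe_mul, mul_assoc, mul_inv_cancel, mul_one] at hdiff'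
  have hinter : ⇑(π f)⁻¹ '' (graph f ∩ graph g) ∈ E := by
    refine hsmall _ ?_ (Cardinal.mk_image_le.trans_lt ?_)
    · rintro _ ⟨y, ⟨hy, -⟩, rfl⟩
      rw [← hπ f] at hy
      obtain ⟨m, hm, rfl⟩ := hy
      simpa using hm
    · refine lt_of_le_of_lt ?_ (had f.1 f.2 g.1 g.2 fun h => hne (Subtype.ext h))
      refine (Cardinal.mk_le_mk_of_subset ?_).trans
        (Cardinal.mk_image_le (f := fun y => p (y, f.1 y)))
      rintro _ ⟨⟨y, rfl⟩, ⟨y', h⟩⟩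
      obtain ⟨rfl, h⟩ := Prod.mk.inj (p.injective h)
      exact ⟨y', h.symm, rfl⟩
  refine hME (hE.subset _ (hE.union _ hdiff' _ hinter) M ?_)
  rw [← Set.image_union, Set.sdiff_union_inter, ← hπ f, ← Set.image_comp, ← Equiv.Perm.coe_mul]
  simp

theorem exists_compl_mem (hE : SmallIndexIdeal E) : ∃ U : Set Y, #U < #Y ∧ Uᶜ ∈ E := by
  obtain ⟨U, hU, hUE⟩ := hE.exists_avoiding_of_mk_lt
  obtain ⟨S, hS, hS'⟩ := exists_moiety Y
  have key : ∀ R : Set Y, #(Rᶜ : Set Y) = #Y → Uᶜ ∩ R ∈ E := by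
    intro R hR
    refine hE.mem_of_forall_mk_lt (le_antisymm (Cardinal.mk_set_le _) ?_) fun A hA hA' =>
      hUE A hA' ?_
    · rw [← hR]
      exact Cardinal.mk_le_mk_of_subset (Set.compl_subset_compl.2 Set.inter_subset_right)
    · exact Set.disjoint_left.2 fun y hy hyU => (hA hy).1 hyU
  refine ⟨U, hU, ?_⟩
  rw [← Set.inter_union_compl Uᶜ S]
  exact hE.union _ (key S hS') _ (key Sᶜ (by rwa [compl_compl]))

end SmallIndexIdeal

end SmallIndexIdeal

section RelFreeBasis

/-- The family `b` generates `G`, and every map from `b` to `G` extends to an endomorphism. -/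
structure IsRelFreeBasis {X G : Type*} [Group G] (b : X → G) : Prop where
  closure_range : Subgroup.closure (Set.range b) = ⊤
  exists_hom : ∀ f : X → G, ∃ φ : G →* G, ∀ x, φ (b x) = f x

/-- The automorphisms fixing `b x` for `x ∉ Z` and mapping `⟨b '' Z⟩` onto itself. -/
def supportedAut {X G : Type*} [Group G] (b : X → G) (Z : Set X) : Subgroup (MulAut G) where
  carrier := {φ | (∀ x ∉ Z, φ (b x) = b x) ∧
    (Subgroup.closure (b '' Z)).map φ.toMonoidHom = Subgroup.closure (b '' Z)}
  one_mem' := ⟨fun _ _ => rfl, Subgroup.map_id _⟩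
  mul_mem' := by
    rintro φ ψ ⟨h₁, h₂⟩ ⟨h₃, h₄⟩
    refine ⟨fun x hx => ?_, ?_⟩
    · rw [MulAut.mul_apply, h₃ x hx, h₁ x hx]
    · have : (φ * ψ).toMonoidHom = φ.toMonoidHom.comp ψ.toMonoidHom := rfl
      rw [this, ← Subgroup.map_map, h₄, h₂]
  inv_mem' := by
    rintro φ ⟨h₁, h₂⟩
    refine ⟨fun x hx => ?_, ?_⟩
    · nth_rewrite 1 [← h₁ x hx]
      exact MulAut.inv_apply_self _ _ _
    · nth_rewrite 1 [← h₂]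
      rw [Subgroup.map_map]
      convert Subgroup.map_id _
      ext g
      exact φ.symm_apply_apply g

section

variable {X G : Type*} [Group G] {b : X → G} {Z Z' : Set X} {φ ψ : MulAut G}

theorem apply_mem_closure_image {x : X} (hx : x ∈ Z) : b x ∈ Subgroup.closure (b '' Z) :=
  Subgroup.subset_closure (Set.mem_image_of_mem b hx)

theorem supportedAut_apply_mem (h : φ ∈ supportedAut b Z) {g : G}
    (hg : g ∈ Subgroup.closure (b '' Z)) : φ g ∈ Subgroup.closure (b '' Z) :=
  h.2 ▸ Subgroup.mem_map_of_mem φ.toMonoidHom hg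

theorem mem_supportedAut_of (h : ∀ x ∉ Z, φ (b x) = b x)
    (h₁ : ∀ x ∈ Z, φ (b x) ∈ Subgroup.closure (b '' Z))
    (h₂ : ∀ x ∈ Z, φ⁻¹ (b x) ∈ Subgroup.closure (b '' Z)) : φ ∈ supportedAut b Z := by
  refine ⟨h, le_antisymm ?_ ?_⟩
  · rw [Subgroup.map_le_iff_le_comap, Subgroup.closure_le]
    rintro _ ⟨x, hx, rfl⟩
    exact h₁ x hx
  · rw [Subgroup.closure_le]
    rintro _ ⟨x, hx, rfl⟩
    exact ⟨φ⁻¹ (b x), h₂ x hx, φ.apply_symm_apply (b x)⟩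

theorem supportedAut_mono (h : Z ⊆ Z') : supportedAut b Z ≤ supportedAut b Z' := by
  have key : ∀ φ ∈ supportedAut b Z, ∀ x ∈ Z', φ (b x) ∈ Subgroup.closure (b '' Z') := by
    intro φ hφ x hx
    by_cases hxZ : x ∈ Z
    · exact Subgroup.closure_mono (Set.image_mono h)
        (supportedAut_apply_mem hφ (apply_mem_closure_image hxZ))
    · rw [hφ.1 x hxZ]
      exact apply_mem_closure_image hx
  exact fun φ hφ => mem_supportedAut_of (fun x hx => hφ.1 x fun hx' => hx (h hx')) (key φ hφ)
    (key φ⁻¹ (inv_mem hφ))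

theorem supportedAut_apply_eq (h : φ ∈ supportedAut b Z) (hd : Disjoint Z Z') {g : G}
    (hg : g ∈ Subgroup.closure (b '' Z')) : φ g = g := by
  have : Subgroup.closure (b '' Z') ≤ φ.toMonoidHom.eqLocus (MonoidHom.id G) := by
    rw [Subgroup.closure_le]
    rintro _ ⟨x, hx, rfl⟩
    exact h.1 x fun hx' => Set.disjoint_left.1 hd hx' hx
  exact this hg

theorem supportedAut_comp {X' : Type*} (e : X' ≃ X) (Z : Set X') :
    supportedAut (b ∘ e) Z = supportedAut b (e '' Z) := by
  ext φ
  change (_ ∧ _) ↔ (_ ∧ _)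
  rw [Set.image_comp, e.forall_congr_left]
  simp [Set.mem_image_equiv]

end

namespace IsRelFreeBasis

variable {X G : Type*} [Group G] {b : X → G} {Z Z' : Set X}

theorem ext (hb : IsRelFreeBasis b) {φ ψ : MulAut G} (h : ∀ x, φ (b x) = ψ (b x)) : φ = ψ := by
  have : φ.toMonoidHom = ψ.toMonoidHom := by
    refine MonoidHom.eq_of_eqOn_dense hb.closure_range ?_
    rintro _ ⟨x, rfl⟩
    exact h x
  ext g
  exact DFunLike.congr_fun this g

theorem exists_mulAut (hb : IsRelFreeBasis b) (φ ψ : G →* G) (h : ∀ x, φ (ψ (b x)) = b x)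
    (h' : ∀ x, ψ (φ (b x)) = b x) : ∃ θ : MulAut G, (∀ x, θ (b x) = φ (b x)) ∧
      ∀ x, θ⁻¹ (b x) = ψ (b x) := by
  refine ⟨φ.toMulEquiv ψ ?_ ?_, fun _ => rfl, fun _ => rfl⟩ <;>
  · refine MonoidHom.eq_of_eqOn_dense hb.closure_range ?_
    rintro _ ⟨x, rfl⟩
    simp [h, h']

theorem comp (hb : IsRelFreeBasis b) {X' : Type*} (e : X' ≃ X) : IsRelFreeBasis (b ∘ e) where
  closure_range := by rw [e.surjective.range_comp, hb.closure_range]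
  exists_hom f := by
    obtain ⟨φ, hφ⟩ := hb.exists_hom (f ∘ e.symm)
    exact ⟨φ, fun x => by simp [hφ]⟩

theorem commute (hb : IsRelFreeBasis b) {φ ψ : MulAut G} (hd : Disjoint Z Z')
    (hφ : φ ∈ supportedAut b Z) (hψ : ψ ∈ supportedAut b Z') : φ * ψ = ψ * φ := by
  refine hb.ext fun x => ?_
  simp only [MulAut.mul_apply]
  by_cases hx : x ∈ Z
  · rw [hψ.1 x (Set.disjoint_left.1 hd hx),
      supportedAut_apply_eq hψ hd.symm (supportedAut_apply_mem hφ (apply_mem_closure_image hx))]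
  · by_cases hx' : x ∈ Z'
    · rw [hφ.1 x hx,
        supportedAut_apply_eq hφ hd (supportedAut_apply_mem hψ (apply_mem_closure_image hx'))]
    · rw [hφ.1 x hx, hψ.1 x hx', hφ.1 x hx]

theorem exists_glue (hb : IsRelFreeBasis b) {I : Type*} (r : X → I) (a : I → MulAut G)
    (ha : ∀ i, a i ∈ supportedAut b (r ⁻¹' {i})) :
    ∃ θ : MulAut G, (∀ x, θ (b x) = a (r x) (b x)) ∧ ∀ x, θ⁻¹ (b x) = (a (r x))⁻¹ (b x) := by
  have key : ∀ a : I → MulAut G, ∀ φ : G →* G, (∀ x, φ (b x) = a (r x) (b x)) →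
      ∀ i, ∀ g ∈ Subgroup.closure (b '' (r ⁻¹' {i})), φ g = a i g := by
    intro a φ h i g hg
    have : Subgroup.closure (b '' (r ⁻¹' {i})) ≤ φ.eqLocus (a i).toMonoidHom := by
      rw [Subgroup.closure_le]
      rintro _ ⟨x, rfl, rfl⟩
      exact h x
    exact this hg
  obtain ⟨φ, hφ⟩ := hb.exists_hom fun x => a (r x) (b x)
  obtain ⟨ψ, hψ⟩ := hb.exists_hom fun x => (a (r x))⁻¹ (b x)
  have hmem : ∀ x, b x ∈ Subgroup.closure (b '' (r ⁻¹' {r x})) :=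
    fun x => apply_mem_closure_image rfl
  obtain ⟨θ, h₁, h₂⟩ := hb.exists_mulAut φ ψ
    (fun x => by
      rw [hψ, key a φ hφ (r x) _ (supportedAut_apply_mem (inv_mem (ha _)) (hmem x))]
      exact MulAut.apply_inv_self _ _ _)
    (fun x => by
      rw [hφ, key (fun i => (a i)⁻¹) ψ hψ (r x) _ (supportedAut_apply_mem (ha _) (hmem x))]
      exact MulAut.inv_apply_self _ _ _)
  exact ⟨θ, fun x => (h₁ x).trans (hφ x), fun x => (h₂ x).trans (hψ x)⟩

theorem exists_permAut (hb : IsRelFreeBasis b) (π : Equiv.Perm X) :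
    ∃ θ : MulAut G, ∀ x, θ (b x) = b (π x) := by
  obtain ⟨φ, hφ⟩ := hb.exists_hom fun x => b (π x)
  obtain ⟨ψ, hψ⟩ := hb.exists_hom fun x => b (π⁻¹ x)
  obtain ⟨θ, hθ, -⟩ := hb.exists_mulAut φ ψ (fun x => by simp [hφ, hψ])
    (fun x => by simp [hφ, hψ])
  exact ⟨θ, fun x => (hθ x).trans (hφ x)⟩

/-- The action of permutations of the basis by automorphisms. -/
noncomputable def permAut (hb : IsRelFreeBasis b) : Equiv.Perm X →* MulAut G :=
  MonoidHom.mk' (fun π => (hb.exists_permAut π).choose) fun π ρ => hb.ext fun x => by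
    rw [MulAut.mul_apply, (hb.exists_permAut _).choose_spec, (hb.exists_permAut _).choose_spec,
      (hb.exists_permAut _).choose_spec, Equiv.Perm.mul_apply]

@[simp]
theorem permAut_apply (hb : IsRelFreeBasis b) (π : Equiv.Perm X) (x : X) :
    hb.permAut π (b x) = b (π x) :=
  (hb.exists_permAut π).choose_spec x

theorem permAut_mem (hb : IsRelFreeBasis b) {π : Equiv.Perm X} (h : ∀ x ∉ Z, π x = x) :
    hb.permAut π ∈ supportedAut b Z := by
  have h' : ∀ x ∈ Z, π x ∈ Z := fun x hx => by
    by_contra hx'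
    rw [π.injective (h _ hx')] at hx'
    exact hx' hx
  have h'' : ∀ x ∈ Z, π⁻¹ x ∈ Z := fun x hx => by
    by_contra hx'
    have := h _ hx'
    rw [Equiv.Perm.coe_inv, Equiv.apply_symm_apply] at this
    exact hx' (this ▸ hx)
  refine mem_supportedAut_of (fun x hx => by rw [permAut_apply, h x hx])
    (fun x hx => ?_) (fun x hx => ?_)
  · rw [permAut_apply]
    exact apply_mem_closure_image (h' x hx)
  · rw [← map_inv, permAut_apply]
    exact apply_mem_closure_image (h'' x hx)

theorem map_permAut_closure (hb : IsRelFreeBasis b) (π : Equiv.Perm X) :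
    (Subgroup.closure (b '' Z)).map (hb.permAut π).toMonoidHom =
      Subgroup.closure (b '' (π '' Z)) := by
  rw [MonoidHom.map_closure, Set.image_image, Set.image_image]
  congr 1
  exact Set.image_congr fun x _ => hb.permAut_apply π x

theorem conj_mem (hb : IsRelFreeBasis b) (π : Equiv.Perm X) {φ : MulAut G}
    (hφ : φ ∈ supportedAut b Z) :
    hb.permAut π * φ * (hb.permAut π)⁻¹ ∈ supportedAut b (π '' Z) := by
  have key : ∀ φ ∈ supportedAut b Z, ∀ x ∈ π '' Z,
      (hb.permAut π * φ * (hb.permAut π)⁻¹) (b x) ∈ Subgroup.closure (b '' (π '' Z)) := by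
    rintro φ hφ _ ⟨x, hx, rfl⟩
    rw [MulAut.mul_apply, ← map_inv, permAut_apply, Equiv.Perm.coe_inv, Equiv.symm_apply_apply,
      MulAut.mul_apply, ← map_permAut_closure]
    exact Subgroup.mem_map_of_mem _ (supportedAut_apply_mem hφ (apply_mem_closure_image hx))
  refine mem_supportedAut_of (fun x hx => ?_) (key φ hφ) ?_
  · rw [MulAut.mul_apply, ← map_inv, permAut_apply, MulAut.mul_apply, hφ.1, permAut_apply,
      Equiv.Perm.coe_inv, Equiv.apply_symm_apply]
    exact fun h => hx ⟨_, h, π.apply_symm_apply x⟩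
  · rw [show (hb.permAut π * φ * (hb.permAut π)⁻¹)⁻¹ =
      hb.permAut π * φ⁻¹ * (hb.permAut π)⁻¹ by group]
    exact key _ (inv_mem hφ)

theorem supportedAut_le_of_image_le (hb : IsRelFreeBasis b) {Sg : Subgroup (MulAut G)}
    {π : Equiv.Perm X} (hπ : hb.permAut π ∈ Sg) (h : supportedAut b (π '' Z) ≤ Sg) :
    supportedAut b Z ≤ Sg := by
  intro φ hφ
  have := mul_mem (mul_mem (inv_mem hπ) (h (hb.conj_mem π hφ))) hπ
  simpa [mul_assoc] using this

end IsRelFreeBasis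

end RelFreeBasis

section SupportedSubgroups

namespace IsRelFreeBasis

variable {X G : Type*} [Group G] {b : X → G}

/-- Along a partition, some block has all its supported automorphisms in `Sg` up to a factor
supported off the block. -/
theorem exists_forall_exists_mul_mem (hb : IsRelFreeBasis b) {Sg : Subgroup (MulAut G)}
    {I : Type*} (r : X → I) {cl : MulAut G → I} (hcl : ∀ φ ψ, cl φ = cl ψ → φ⁻¹ * ψ ∈ Sg) :
    ∃ i, ∀ a ∈ supportedAut b (r ⁻¹' {i}),
      ∃ τ ∈ supportedAut b (r ⁻¹' {i})ᶜ, a * τ ∈ Sg := by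
  obtain ⟨i, hi⟩ : ∃ i, ∀ a ∈ supportedAut b (r ⁻¹' {i}),
      ∃ τ ∈ supportedAut b (r ⁻¹' {i})ᶜ, cl (a * τ) = i := by
    by_contra! hcon
    choose a ha hne using hcon
    obtain ⟨θ, h₁, h₂⟩ := hb.exists_glue r a ha
    have hblock : ∀ j, ∀ φ ∈ supportedAut b (r ⁻¹' {j}), ∀ x, r x = j → ∀ i, r x ≠ i →
        φ (b x) ∈ Subgroup.closure (b '' (r ⁻¹' {i})ᶜ) := by
      rintro j φ hφ x rfl i hx
      refine Subgroup.closure_mono (Set.image_mono ?_)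
        (supportedAut_apply_mem hφ (apply_mem_closure_image rfl))
      rintro y hy rfl
      exact hx hy.symm
    refine hne (cl θ) ((a (cl θ))⁻¹ * θ) ?_ (by rw [mul_inv_cancel_left])
    refine mem_supportedAut_of (fun x hx => ?_) (fun x hx => ?_) (fun x hx => ?_)
    · have hx : r x = cl θ := by simpa using hx
      rw [MulAut.mul_apply, h₁, hx]
      exact MulAut.inv_apply_self _ _ _
    · have hm := hblock _ _ (ha (r x)) x rfl (cl θ) hx
      rw [MulAut.mul_apply, h₁, supportedAut_apply_eq (inv_mem (ha _)) disjoint_compl_right hm]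
      exact hm
    · rw [mul_inv_rev, inv_inv, MulAut.mul_apply, (ha (cl θ)).1 x hx, h₂]
      exact hblock _ _ (inv_mem (ha (r x))) x rfl (cl θ) hx
  refine ⟨i, fun a ha => ?_⟩
  obtain ⟨τ, hτ, h⟩ := hi a ha
  obtain ⟨τ', hτ', h'⟩ := hi 1 (one_mem _)
  refine ⟨τ'⁻¹ * τ, mul_mem (inv_mem hτ') hτ, ?_⟩
  have := hcl _ _ (h'.trans h.symm)
  rwa [one_mul, ← mul_assoc, ← hb.commute disjoint_compl_right ha (inv_mem hτ'), mul_assoc] at this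

end IsRelFreeBasis

/-- Translation of the `ℤ`-coordinate by an amount depending on the other coordinates `i, j`. -/
def chainShift (I J K : Type*) (d : I × J → ℤ) : Equiv.Perm (I × J × ℤ × K) where
  toFun p := (p.1, p.2.1, p.2.2.1 + d (p.1, p.2.1), p.2.2.2)
  invFun p := (p.1, p.2.1, p.2.2.1 - d (p.1, p.2.1), p.2.2.2)
  left_inv p := by simp
  right_inv p := by simp

section

variable {I J K : Type*}

@[simp]
theorem chainShift_apply (d : I × J → ℤ) (i : I) (j : J) (k : ℤ) (x : K) :
    chainShift I J K d (i, j, k, x) = (i, j, k + d (i, j), x) := rfl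

theorem chainShift_mul (d d' : I × J → ℤ) :
    chainShift I J K d * chainShift I J K d' = chainShift I J K (d + d') := by
  ext p <;> simp [chainShift, add_comm, add_left_comm]

theorem chainShift_zero : chainShift I J K 0 = 1 := by
  ext p <;> simp [chainShift]

theorem chainShift_inv (d : I × J → ℤ) : (chainShift I J K d)⁻¹ = chainShift I J K (-d) := by
  rw [inv_eq_iff_mul_eq_one, chainShift_mul]
  ext p <;> simp [chainShift]

end

namespace IsRelFreeBasis

variable {I J K G : Type*} [Group G] {b : I × J × ℤ × K → G}

theorem exists_eq_mul_conj_chainShift (hb : IsRelFreeBasis b) (i₀ : I) (j₀ : J) {d : I × J → ℤ}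
    (hd : d (i₀, j₀) = 1) {g : MulAut G}
    (hg : g ∈ supportedAut b {p | p.1 = i₀ ∧ p.2.1 = j₀ ∧ p.2.2.1 = 0}) :
    ∃ h ∈ supportedAut b {p | p.1 = i₀}, h = g *
      (hb.permAut (chainShift I J K d) * h * (hb.permAut (chainShift I J K d))⁻¹) := by
  classical
  let s : ℤ → MulAut G := fun k => hb.permAut (chainShift I J K (k • d))
  let a : I × J × ℤ → MulAut G := fun q =>
    if q.1 = i₀ ∧ q.2.1 = j₀ ∧ 0 ≤ q.2.2 then s q.2.2 * g * (s q.2.2)⁻¹ else 1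
  let r : I × J × ℤ × K → I × J × ℤ := fun p => (p.1, p.2.1, p.2.2.1)
  have ha : ∀ q, a q ∈ supportedAut b (r ⁻¹' {q}) := by
    intro q
    simp only [a]
    split_ifs with hq
    · refine supportedAut_mono ?_ (hb.conj_mem _ hg)
      obtain ⟨i, j, k⟩ := q
      obtain ⟨rfl, rfl, hk⟩ := hq
      rintro _ ⟨⟨i, j, l, x⟩, ⟨h₁, h₂, h₃⟩, rfl⟩
      simp only at h₁ h₂ h₃
      simp [r, h₁, h₂, h₃, hd]
    · exact one_mem _
  obtain ⟨h, h₁, h₂⟩ := hb.exists_glue r a ha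
  refine ⟨h, ?_, hb.ext ?_⟩
  · have ha' : ∀ q, a q ∈ supportedAut b {p | p.1 = i₀} := by
      intro q
      by_cases hq : q.1 = i₀
      · refine supportedAut_mono ?_ (ha q)
        rintro p rfl
        exact hq
      · simp only [a, hq, false_and, if_false]
        exact one_mem _
    exact mem_supportedAut_of (fun x hx => by rw [h₁, (ha' _).1 x hx])
      (fun x hx => by rw [h₁]; exact supportedAut_apply_mem (ha' _) (apply_mem_closure_image hx))
      (fun x hx => by
        rw [h₂]
        exact supportedAut_apply_mem (inv_mem (ha' _)) (apply_mem_closure_image hx))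
  · rintro ⟨i, j, k, x⟩
    rw [h₁, MulAut.mul_apply, MulAut.mul_apply, MulAut.mul_apply, ← map_inv, chainShift_inv,
      permAut_apply, chainShift_apply, h₁]
    by_cases hij : i = i₀ ∧ j = j₀
    · obtain ⟨rfl, rfl⟩ := hij
      by_cases hk : 0 < k
      · have hs : s k = hb.permAut (chainShift I J K d) * s (k - 1) := by
          simp only [s]
          rw [← map_mul, chainShift_mul, sub_smul, one_smul, add_sub_cancel]
        have hk1 : 0 ≤ k - 1 := by omega
        have hak : a (i, j, k) = hb.permAut (chainShift I J K d) * a (i, j, k - 1) *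
            (hb.permAut (chainShift I J K d))⁻¹ := by
          simp only [a, hk.le, hk1, and_self, if_true, hs]
          group
        have hb' : b (i, j, k + (-d) (i, j), x) = (hb.permAut (chainShift I J K d))⁻¹
            (b (i, j, k, x)) := by
          rw [← map_inv, chainShift_inv, permAut_apply, chainShift_apply]
        have hr : r (i, j, k + (-d) (i, j), x) = (i, j, k - 1) := by
          simp [r, hd, sub_eq_add_neg]
        have hab : hb.permAut (chainShift I J K d) (a (i, j, k - 1)
            ((hb.permAut (chainShift I J K d))⁻¹ (b (i, j, k, x)))) =
            a (i, j, k) (b (i, j, k, x)) := by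
          rw [hak]
          rfl
        rw [hr, hb', hab]
        symm
        refine supportedAut_apply_eq hg ?_ (supportedAut_apply_mem (ha _)
          (apply_mem_closure_image rfl))
        rw [Set.disjoint_left]
        rintro p ⟨-, -, hp⟩ hp'
        have : p.2.2.1 = k := by
          have := Set.mem_preimage.1 hp'
          simp only [r, Set.mem_singleton_iff, Prod.mk.injEq] at this
          exact this.2.2
        omega
      · have hr : a (r (i, j, k + (-d) (i, j), x)) = 1 := by
          simp only [a, r]
          rw [if_neg]
          simp [hd]
          omega
        rw [hr, MulAut.one_apply, permAut_apply, chainShift_apply]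
        simp only [Pi.neg_apply, neg_add_cancel_right]
        rcases (not_lt.1 hk).eq_or_lt with rfl | hk'
        · simp [a, r, s, chainShift_zero]
        · rw [hg.1]
          · simp [a, r, hk'.not_ge]
          · simp [hk'.ne]
    · have hr : ∀ l, a (i, j, l) = 1 := fun l => by
        simp only [a]
        rw [if_neg]
        exact fun h => hij ⟨h.1, h.2.1⟩
      simp only [r, hr, MulAut.one_apply, permAut_apply, chainShift_apply]
      simp only [Pi.neg_apply, neg_add_cancel_right]
      rw [hg.1]
      exact fun h => hij ⟨h.1, h.2.1⟩

theorem exists_supportedAut_le (hb : IsRelFreeBasis b) {Sg : Subgroup (MulAut G)}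
    {cl : MulAut G → I} (hcl : ∀ φ ψ, cl φ = cl ψ → φ⁻¹ * ψ ∈ Sg)
    (hIJ : ∀ f : Set J → I, ¬ Function.Injective f) :
    ∃ i₀ j₀, supportedAut b {p | p.1 = i₀ ∧ p.2.1 = j₀ ∧ p.2.2.1 = 0} ≤ Sg := by
  classical
  obtain ⟨i₀, hi₀⟩ := hb.exists_forall_exists_mul_mem Prod.fst hcl
  refine ⟨i₀, ?_⟩
  by_contra! hcon
  let D : Set J → I × J → ℤ := fun S q => if q.1 = i₀ ∧ q.2 ∈ S then 1 else 0
  have key : ∀ S S', cl (hb.permAut (chainShift I J K (D S))) =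
      cl (hb.permAut (chainShift I J K (D S'))) → S' ⊆ S := by
    intro S S' hSS j₀ hj
    by_contra hj'
    refine hcon j₀ fun g hg => ?_
    have hn := hcl _ _ hSS
    rw [← map_inv, ← map_mul, chainShift_inv, chainShift_mul] at hn
    set d := -D S + D S' with hd
    have hd1 : d (i₀, j₀) = 1 := by simp [hd, D, hj, hj']
    obtain ⟨h, hh, heq⟩ := hb.exists_eq_mul_conj_chainShift i₀ j₀ hd1 hg
    obtain ⟨τ, hτ, hm⟩ := hi₀ h hh
    set n := hb.permAut (chainShift I J K d) with hn_def
    have hnm : n ∈ supportedAut b (Prod.fst ⁻¹' {i₀}) := by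
      refine hb.permAut_mem ?_
      rintro ⟨i, j, k, x⟩ hx
      have : i ≠ i₀ := hx
      simp [hd, D, this]
    have hcomm := hb.commute disjoint_compl_right hnm hτ
    have hg' : g = h * n * h⁻¹ * n⁻¹ := by
      calc g = g * (n * h * n⁻¹) * (n * h * n⁻¹)⁻¹ := by group
        _ = h * (n * h * n⁻¹)⁻¹ := by rw [← heq]
        _ = h * n * h⁻¹ * n⁻¹ := by group
    have hconj : h * n * h⁻¹ = (h * τ) * n * (h * τ)⁻¹ := by
      rw [mul_assoc h τ n, ← hcomm]
      group
    rw [hg', hconj]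
    exact mul_mem (mul_mem (mul_mem hm hn) (inv_mem hm)) (inv_mem hn)
  exact hIJ (fun S => cl (hb.permAut (chainShift I J K (D S)))) fun S S' h =>
    (key S' S h.symm).antisymm (key S S' h)

end IsRelFreeBasis

end SupportedSubgroups

section PartialSwap

variable {Y : Type*}

open Classical in
/-- The involution of `Y ⊕ Y ⊕ Y` exchanging the first two copies of each `y ∈ D`. -/
noncomputable def leftSwap (D : Set Y) : Equiv.Perm (Y ⊕ Y ⊕ Y) :=
  Function.Involutive.toPerm (fun
    | .inl y => if y ∈ D then .inr (.inl y) else .inl y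
    | .inr (.inl y) => if y ∈ D then .inl y else .inr (.inl y)
    | .inr (.inr y) => .inr (.inr y)) (by
    rintro (y | y | y) <;> by_cases h : y ∈ D <;> simp [h])

open Classical in
/-- The involution of `Y ⊕ Y ⊕ Y` exchanging the last two copies of each `y ∈ D`. -/
noncomputable def rightSwap (D : Set Y) : Equiv.Perm (Y ⊕ Y ⊕ Y) :=
  Function.Involutive.toPerm (fun
    | .inl y => .inl y
    | .inr (.inl y) => if y ∈ D then .inr (.inr y) else .inr (.inl y)
    | .inr (.inr y) => if y ∈ D then .inr (.inl y) else .inr (.inr y)) (by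
    rintro (y | y | y) <;> by_cases h : y ∈ D <;> simp [h])

section

open Classical

@[simp]
theorem leftSwap_inl (D : Set Y) (y : Y) :
    leftSwap D (.inl y) = if y ∈ D then .inr (.inl y) else .inl y := rfl

@[simp]
theorem leftSwap_inr_inl (D : Set Y) (y : Y) :
    leftSwap D (.inr (.inl y)) = if y ∈ D then .inl y else .inr (.inl y) := rfl

@[simp]
theorem leftSwap_inr_inr (D : Set Y) (y : Y) : leftSwap D (.inr (.inr y)) = .inr (.inr y) := rfl

@[simp]
theorem rightSwap_inl (D : Set Y) (y : Y) : rightSwap D (.inl y) = .inl y := rfl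

@[simp]
theorem rightSwap_inr_inl (D : Set Y) (y : Y) :
    rightSwap D (.inr (.inl y)) = if y ∈ D then .inr (.inr y) else .inr (.inl y) := rfl

@[simp]
theorem rightSwap_inr_inr (D : Set Y) (y : Y) :
    rightSwap D (.inr (.inr y)) = if y ∈ D then .inr (.inl y) else .inr (.inr y) := rfl

end

theorem leftSwap_empty : leftSwap (∅ : Set Y) = 1 := by
  ext (y | y | y) <;> simp

theorem leftSwap_mul (A B : Set Y) : leftSwap A * leftSwap B = leftSwap (symmDiff A B) := by
  refine Equiv.ext ?_
  rintro (y | y | y) <;> by_cases hA : y ∈ A <;> by_cases hB : y ∈ B <;>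
    simp [hA, hB, Set.mem_symmDiff]

theorem leftSwap_inv (A : Set Y) : (leftSwap A)⁻¹ = leftSwap A := by
  rw [inv_eq_iff_mul_eq_one, leftSwap_mul, symmDiff_self]
  exact leftSwap_empty

theorem leftSwap_eq_of_subset {A B : Set Y} (h : A ⊆ B) :
    rightSwap A * leftSwap B * rightSwap A * leftSwap B * rightSwap A = leftSwap A := by
  refine Equiv.ext ?_
  rintro (y | y | y) <;> by_cases hA : y ∈ A <;> by_cases hB : y ∈ B <;>
    first | exact absurd (h hA) hB | simp [hA, hB]

/-- The diagonal action of a permutation of `Y` on `Y ⊕ Y ⊕ Y`. -/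
def diagPerm : Equiv.Perm Y →* Equiv.Perm (Y ⊕ Y ⊕ Y) where
  toFun π := Equiv.sumCongr π (Equiv.sumCongr π π)
  map_one' := by ext (y | y | y) <;> rfl
  map_mul' π ρ := by ext (y | y | y) <;> rfl

theorem diagPerm_conj_leftSwap (π : Equiv.Perm Y) (A : Set Y) :
    diagPerm π * leftSwap A * (diagPerm π)⁻¹ = leftSwap (π '' A) := by
  rw [mul_inv_eq_iff_eq_mul]
  refine Equiv.ext ?_
  rintro (y | y | y) <;> by_cases hA : y ∈ A <;> simp [hA, diagPerm]

theorem leftSwap_image_subset_range_inr {D : Set Y} {Z : Set (Y ⊕ Y ⊕ Y)}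
    (h : ∀ y, .inl y ∈ Z → y ∈ D) (h' : ∀ y, .inr (.inl y) ∉ Z) :
    leftSwap D '' Z ⊆ Set.range Sum.inr := by
  rintro _ ⟨y | y | y, hy, rfl⟩
  · simp [h y hy]
  · exact absurd hy (h' y)
  · simp

end PartialSwap

section SumBasis

universe u v

variable {Y : Type u} {G : Type v} [Group G] {b : Y ⊕ Y ⊕ Y → G}
  {Sg : Subgroup (MulAut G)} {cl : MulAut G → Y}

namespace IsRelFreeBasis

theorem smallIndexIdeal_leftSwap (hb : IsRelFreeBasis b)
    (hcl : ∀ φ ψ, cl φ = cl ψ → φ⁻¹ * ψ ∈ Sg) (hW : supportedAut b (Set.range Sum.inr) ≤ Sg) :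
    SmallIndexIdeal {D : Set Y | hb.permAut (leftSwap D) ∈ Sg} := by
  have hsub : ∀ A, hb.permAut (leftSwap A) ∈ Sg → ∀ B ⊆ A, hb.permAut (leftSwap B) ∈ Sg := by
    intro A hA B hBA
    have hR : hb.permAut (rightSwap B) ∈ Sg := hW <| hb.permAut_mem <| by
      rintro (y | y) hy
      · rfl
      · simp at hy
    rw [← leftSwap_eq_of_subset hBA]
    simp only [map_mul]
    exact mul_mem (mul_mem (mul_mem (mul_mem hR hA) hR) hA) hR
  refine ⟨?_, hsub, ?_, ⟨fun D => cl (hb.permAut (leftSwap D)), fun A B h => ?_⟩,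
    ⟨fun π => cl (hb.permAut (diagPerm π)), fun π π' h A hA => ?_⟩⟩
  · rw [Set.mem_ofPred_eq, leftSwap_empty, map_one]
    exact one_mem _
  · intro A hA B hB
    have hAB : symmDiff A (B \ A) = A ∪ B := by
      rw [← Set.union_sdiff_self, (disjoint_sdiff_self_right).symmDiff_eq_sup]
      rfl
    rw [Set.mem_ofPred_eq, ← hAB, ← leftSwap_mul, map_mul]
    exact mul_mem hA (hsub B hB _ Set.sdiff_subset)
  · have := hcl _ _ h
    rw [← map_inv, leftSwap_inv, ← map_mul, leftSwap_mul] at this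
    exact hsub _ this _ fun x hx => Or.inl hx
  · have hn := hcl _ _ h
    rw [← map_inv, ← map_inv, ← map_mul, ← map_mul] at hn
    rw [Set.mem_ofPred_eq, ← diagPerm_conj_leftSwap, map_mul, map_mul, map_inv]
    exact mul_mem (mul_mem hn hA) (inv_mem hn)

theorem exists_forall_supportedAut_le [Infinite Y] (hb : IsRelFreeBasis b)
    (hcl : ∀ φ ψ, cl φ = cl ψ → φ⁻¹ * ψ ∈ Sg) (hW : supportedAut b (Set.range Sum.inr) ≤ Sg) :
    ∃ U : Set Y, #U < #Y ∧ ∀ Z : Set (Y ⊕ Y ⊕ Y), Disjoint Z (Sum.inl '' U) →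
      #((Sum.inl '' U ∪ Z)ᶜ : Set (Y ⊕ Y ⊕ Y)) = #Y → supportedAut b Z ≤ Sg := by
  have hE := hb.smallIndexIdeal_leftSwap hcl hW
  obtain ⟨U, hU, hUE⟩ := hE.exists_compl_mem
  refine ⟨U, hU, fun Z hZU hZ => ?_⟩
  have hY2 : #(Y ⊕ Y) = #Y := by simp
  have hY3 : #(Y ⊕ Y ⊕ Y) = #Y := by simp
  let Q : Set Y := {y | y ∉ U ∧ .inl y ∉ Z}
  refine hb.supportedAut_le_of_image_le (π := leftSwap Q) (hE.subset _ hUE Q fun y hy => hy.1) ?_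
  set Z₁ := leftSwap Q '' Z
  have hinl : ∀ y, .inl y ∈ Z₁ → y ∉ U := by
    rintro y ⟨z | z | z, hz, hzy⟩ hyU
    · by_cases hQ : z ∈ Q
      · simp [hQ] at hzy
      · simp only [leftSwap_inl, hQ, if_false, Sum.inl.injEq] at hzy
        subst hzy
        exact Set.disjoint_left.1 hZU hz ⟨z, hyU, rfl⟩
    · by_cases hQ : z ∈ Q
      · simp only [leftSwap_inr_inl, hQ, if_true, Sum.inl.injEq] at hzy
        subst hzy
        exact hQ.1 hyU
      · simp [hQ] at hzy
    · simp at hzy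
  have hcompl : #((Sum.inr ⁻¹' Z₁ : Set (Y ⊕ Y))ᶜ : Set (Y ⊕ Y)) = #Y := by
    refine ((Cardinal.mk_set_le _).trans hY2.le).antisymm (not_lt.1 fun hlt => ?_)
    set S := (Sum.inr ⁻¹' Z₁ : Set (Y ⊕ Y))ᶜ
    have hmem : ∀ p ∉ Z, leftSwap Q p ∉ Z₁ := fun p hp h =>
      hp ((leftSwap Q).injective.mem_set_image.1 h)
    have hsub : (Sum.inl '' U ∪ Z)ᶜ ⊆ Sum.inl '' (Sum.inl ⁻¹' S) ∪ Sum.inr '' S := by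
      rintro (y | y | y) hp
      · have hQ : y ∈ Q := by simpa [Q] using hp
        refine Or.inl ⟨y, ?_, rfl⟩
        simpa [S, hQ] using hmem _ fun h => hp (Or.inr h)
      · refine Or.inr ⟨.inl y, ?_, rfl⟩
        by_cases hQ : y ∈ Q
        · simpa [S, hQ] using hmem _ hQ.2
        · simpa [S, hQ] using hmem _ fun h => hp (Or.inr h)
      · refine Or.inr ⟨.inr y, ?_, rfl⟩
        simpa [S] using hmem _ fun h => hp (Or.inr h)
    rw [← hY3] at hZ hlt
    refine (mk_lt_of_subset_union hsub ?_ ?_).ne hZ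
    · rw [Cardinal.mk_image_eq Sum.inl_injective]
      exact (Cardinal.mk_preimage_of_injective _ _ Sum.inl_injective).trans_lt hlt
    · rwa [Cardinal.mk_image_eq Sum.inr_injective]
  obtain ⟨σ, hσ⟩ : ∃ σ : Equiv.Perm (Y ⊕ Y), ∀ p, .inr p ∈ Z₁ → ∃ q, σ p = .inr q := by
    obtain ⟨e⟩ := Cardinal.eq.1 hY2
    obtain ⟨σ, hσ⟩ := exists_perm_extending (A := Sum.inr ⁻¹' Z₁)
      (fun p => (Sum.inr (e p) : Y ⊕ Y)) (fun p q h => by simpa [Subtype.ext_iff] using h)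
      (hcompl.trans hY2.symm) (by
        refine le_antisymm (Cardinal.mk_set_le _) (hY2.le.trans ?_)
        refine Cardinal.mk_le_of_injective (f := fun y => ⟨Sum.inl y, by simp⟩) ?_
        intro y z h
        simpa using h)
    exact ⟨σ, fun p hp => ⟨e p, hσ ⟨p, hp⟩⟩⟩
  refine hb.supportedAut_le_of_image_le (π := Equiv.sumCongr 1 σ)
    (hW <| hb.permAut_mem <| by
      rintro (y | y) hy
      · rfl
      · simp at hy) ?_
  refine hb.supportedAut_le_of_image_le hUE ((supportedAut_mono ?_).trans hW)
  refine leftSwap_image_subset_range_inr ?_ ?_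
  · rintro y ⟨z | z, hz, hzy⟩
    · obtain rfl : z = y := by simpa using hzy
      exact hinl z hz
    · simp at hzy
  · rintro y ⟨z | z, hz, hzy⟩
    · simp at hzy
    · obtain ⟨q, hq⟩ := hσ z hz
      simp [hq] at hzy

end IsRelFreeBasis

end SumBasis

section MainTheorem

universe u v

namespace IsRelFreeBasis

theorem exists_small_forall_supportedAut_le {X : Type u} [Infinite X] {G : Type v} [Group G]
    {b : X → G} (hb : IsRelFreeBasis b) {Sg : Subgroup (MulAut G)} {cl : MulAut G → X}
    (hcl : ∀ φ ψ, cl φ = cl ψ → φ⁻¹ * ψ ∈ Sg) :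
    ∃ U : Set X, #U < #X ∧ ∀ Z : Set X, Disjoint Z U → #((U ∪ Z)ᶜ : Set X) = #X →
      supportedAut b Z ≤ Sg := by
  have hP : #(X × X × ℤ × X) = #X := by simp
  obtain ⟨e₁⟩ := Cardinal.eq.1 hP
  obtain ⟨i₀, j₀, hW⟩ := (hb.comp e₁).exists_supportedAut_le hcl Function.cantor_injective
  set W : Set (X × X × ℤ × X) := {p | p.1 = i₀ ∧ p.2.1 = j₀ ∧ p.2.2.1 = 0}
  obtain ⟨e₀⟩ : Nonempty (X ⊕ X ⊕ X ≃ X × X × ℤ × X) := Cardinal.eq.1 (by simp)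
  have hcard : ∀ S : Set (X × X × ℤ × X), ∀ f : X → X × X × ℤ × X, Function.Injective f →
      (∀ x, f x ∈ S) → #S = #X := fun S f hf hfS =>
    ((Cardinal.mk_set_le S).trans hP.le).antisymm
      (Cardinal.mk_le_of_injective (f := fun x => ⟨f x, hfS x⟩)
        fun x y h => hf (congrArg Subtype.val h))
  obtain ⟨π, hπ⟩ : ∃ π : Equiv.Perm (X × X × ℤ × X), π '' (e₀ '' Set.range Sum.inr) = W := by
    refine exists_perm_image_eq ?_ ?_
    · rw [hcard W (fun x => (i₀, j₀, 0, x)) (fun x y h => by simpa using h) (fun x => by simp [W]),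
        hcard _ (fun x => e₀ (.inr (.inl x))) (fun x y h => by simpa using h) (fun x => by simp)]
    · rw [hcard Wᶜ (fun x => (i₀, j₀, 1, x)) (fun x y h => by simpa using h) (fun x => by simp [W]),
        hcard _ (fun x => e₀ (.inl x)) (fun x y h => by simpa using h) (fun x => by simp)]
  let e : X ⊕ X ⊕ X ≃ X := (e₀.trans π).trans e₁
  have he : supportedAut (b ∘ e) (Set.range Sum.inr) ≤ Sg := by
    rw [supportedAut_comp] at hW ⊢
    convert hW
    rw [← hπ, Set.image_image, Set.image_image]
    rfl
  obtain ⟨U, hU, hUZ⟩ := (hb.comp e).exists_forall_supportedAut_le hcl he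
  refine ⟨e '' (Sum.inl '' U), ?_, fun Z hZU hZ => ?_⟩
  · rwa [Cardinal.mk_image_eq e.injective, Cardinal.mk_image_eq Sum.inl_injective]
  · have := hUZ (e ⁻¹' Z) ?_ ?_
    · rwa [supportedAut_comp, e.image_preimage] at this
    · rw [← Set.disjoint_image_iff e.injective, e.image_preimage]
      exact hZU
    · rw [← hZ, ← Cardinal.mk_image_eq e.injective, Set.image_compl_eq e.bijective,
        Set.image_union, e.image_preimage]

end IsRelFreeBasis

theorem isRelFreeBasis_mk_of {X : Type*} {V : Subgroup (FreeGroup X)} [V.Normal]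
    (hV : ∀ f : FreeGroup X →* FreeGroup X, V.map f ≤ V) :
    IsRelFreeBasis fun x : X => (QuotientGroup.mk (FreeGroup.of x) : FreeGroup X ⧸ V) where
  closure_range := by
    have := MonoidHom.map_closure (QuotientGroup.mk' V) (Set.range FreeGroup.of)
    rw [FreeGroup.closure_range_of, ← Set.range_comp,
      Subgroup.map_top_of_surjective _ (QuotientGroup.mk'_surjective V)] at this
    exact this.symm
  exists_hom f := by
    refine ⟨QuotientGroup.map V V (FreeGroup.lift fun x => (f x).out)
      (Subgroup.map_le_iff_le_comap.1 (hV _)), fun x => ?_⟩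
    rw [QuotientGroup.map_mk, FreeGroup.lift_apply_of, QuotientGroup.out_eq']

theorem mk_of_injective {X : Type*} {V : Subgroup (FreeGroup X)}
    (hV : ∀ f : FreeGroup X →* FreeGroup X, V.map f ≤ V) (hne : V ≠ ⊤) :
    Function.Injective fun x : X => (QuotientGroup.mk (FreeGroup.of x) : FreeGroup X ⧸ V) := by
  classical
  intro x y h
  by_contra hxy
  refine hne (eq_top_iff.2 fun g _ => ?_)
  have hmem := hV (FreeGroup.lift fun z => if z = y then g else 1)
    (Subgroup.mem_map_of_mem _ (QuotientGroup.eq.1 h))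
  simpa [hxy] using hmem

end MainTheorem

/-- If `G = FreeGroup X ⧸ V` is a relatively free group of infinite rank `κ = #X`
(`V` fully invariant) and `Σ` is a subgroup of `Γ = Aut G` with `|Γ/Σ| ≤ κ`, then there
is a subset `U` of the basis `X̄` with `#U < κ` such that for every moiety `Z` of
`X̄ \ U`, `Σ` contains every automorphism of `G` fixing `X̄ \ Z` pointwise and mapping
the subgroup `⟨Z⟩` onto itself. -/
theorem small_index_subgroup_contains_moiety_stabilizers
    {X : Type*} [Infinite X] (V : Subgroup (FreeGroup X)) [V.Normal]
    (hV : ∀ f : FreeGroup X →* FreeGroup X, V.map f ≤ V)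
    (Sg : Subgroup (MulAut (FreeGroup X ⧸ V)))
    (hSg : Cardinal.mk (MulAut (FreeGroup X ⧸ V) ⧸ Sg) ≤ Cardinal.mk X) :
    ∃ U : Set (FreeGroup X ⧸ V),
      U ⊆ genBasis V ∧
      Cardinal.mk U < Cardinal.mk X ∧
      ∀ Z : Set (FreeGroup X ⧸ V), Z ⊆ genBasis V \ U →
        Cardinal.mk Z = Cardinal.mk (((genBasis V \ U) \ Z : Set (FreeGroup X ⧸ V))) →
        ∀ φ : MulAut (FreeGroup X ⧸ V),
          (∀ x ∈ genBasis V \ Z, φ x = x) →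
          (Subgroup.closure Z).map φ.toMonoidHom = Subgroup.closure Z →
          φ ∈ Sg := by
  by_cases hne : V = ⊤
  · subst hne
    have : Subsingleton (FreeGroup X ⧸ (⊤ : Subgroup (FreeGroup X))) :=
      QuotientGroup.subsingleton_quotient_top
    refine ⟨∅, Set.empty_subset _, ?_, fun Z _ _ φ _ _ => ?_⟩
    · simp [Cardinal.mk_ne_zero, pos_iff_ne_zero]
    · rw [show φ = 1 from MulEquiv.ext fun g => Subsingleton.elim _ _]
      exact one_mem _
  have hb := isRelFreeBasis_mk_of hV
  have hinj := mk_of_injective hV hne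
  set b : X → FreeGroup X ⧸ V := fun x => QuotientGroup.mk (FreeGroup.of x)
  have hrange : genBasis V = Set.range b := rfl
  obtain ⟨ι⟩ := hSg
  obtain ⟨U, hU, hUZ⟩ := hb.exists_small_forall_supportedAut_le (Sg := Sg)
    (cl := fun φ => ι φ) fun φ ψ h => QuotientGroup.eq.1 (ι.injective h)
  refine ⟨b '' U, Set.image_subset_range _ _, Cardinal.mk_image_le.trans_lt hU, ?_⟩
  intro Z hZ hcard φ hfix hmap
  have hbZ : b '' (b ⁻¹' Z) = Z := Set.image_preimage_eq_of_subset fun z hz => (hZ hz).1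
  refine hUZ (b ⁻¹' Z) ?_ ?_ ⟨fun x hx => hfix _ ⟨⟨x, rfl⟩, hx⟩, by rwa [hbZ]⟩
  · exact Set.disjoint_left.2 fun x hx hxU => (hZ hx).2 ⟨x, hxU, rfl⟩
  · have hdiff : b '' (U ∪ b ⁻¹' Z)ᶜ = (genBasis V \ b '' U) \ Z := by
      rw [Set.compl_eq_univ_sdiff, Set.image_sdiff hinj, Set.image_union, hbZ, Set.image_univ,
        Set.sdiff_sdiff, hrange]
    nth_rewrite 1 [← hdiff, Cardinal.mk_image_eq hinj, ← hbZ, Cardinal.mk_image_eq hinj] at hcard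
    refine (Cardinal.mk_set_le _).antisymm (not_lt.1 fun hlt => ?_)
    have hcover : (Set.univ : Set X) ⊆ (U ∪ b ⁻¹' Z) ∪ (U ∪ b ⁻¹' Z)ᶜ := by
      rw [Set.union_compl_self]
    have h₁ : #(U ∪ b ⁻¹' Z : Set X) < #X :=
      mk_lt_of_subset_union subset_rfl hU (hcard.trans_lt hlt)
    exact (mk_lt_of_subset_union hcover h₁ hlt).ne Cardinal.mk_univ
end

section
/- Let G be a relatively free group of infinite rank κ, formalized as G = FreeGroup X ⧸ V with X infinite and V fully invariant, let X̄ be the basis of G given by the images of the generators, and let Γ = Aut G. For σ ∈ Γ, the conjugacy class of σ in Γ is small (of cardinality at most κ = #X) if and only if there exist a natural number s, elements u₁,…,u_s of X̄, and a group word w(*;*₁,…,*_s) in s+1 variables (an element of the free group on s+1 generators, evaluated by substitution) such that σ(x) = w(x;u₁,…,u_s) for all x ∈ X̄ and w(xy;u₁,…,u_s) = w(x;u₁,…,u_s)·w(y;u₁,…,u_s) for all x,y ∈ X̄ (whence in fact σ(g) = w(g;u₁,…,u_s) for all g ∈ G). -/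
open Cardinal

/-- Evaluation of a group word `w` in variables `*, *₁, …, *_s` (an element of the
free group on `Option (Fin s)`, where `none` is the distinguished variable `*`) at
`g, u₁, …, u_s`. -/
def wordEval {G : Type*} [Group G] {s : ℕ} (w : FreeGroup (Option (Fin s)))
    (g : G) (u : Fin s → G) : G :=
  FreeGroup.lift (fun o : Option (Fin s) => o.elim g u) w

section RelativelyFree

variable {X : Type*} {V : Subgroup (FreeGroup X)}

/-- The image of a generator in the quotient `FreeGroup X ⧸ V`. -/
def genBar (V : Subgroup (FreeGroup X)) (x : X) : FreeGroup X ⧸ V :=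
  QuotientGroup.mk (FreeGroup.of x)

theorem map_wordEval {G H : Type*} [Group G] [Group H] (φ : G →* H) {s : ℕ}
    (w : FreeGroup (Option (Fin s))) (g : G) (u : Fin s → G) :
    φ (wordEval w g u) = wordEval w (φ g) (fun i => φ (u i)) := by
  have : φ.comp (FreeGroup.lift fun o : Option (Fin s) => o.elim g u) =
      FreeGroup.lift fun o : Option (Fin s) => o.elim (φ g) fun i => φ (u i) := by
    ext o
    cases o <;> simp
  exact DFunLike.congr_fun this w

/-- Two homomorphisms out of a free group agree on a word as soon as they agree on
a suitable finite set of letters. -/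
theorem exists_finite_lift_congr {H : Type*} [Group H] (v : FreeGroup X) :
    ∃ L : Set X, L.Finite ∧ ∀ f g : X → H, (∀ x ∈ L, f x = g x) →
      FreeGroup.lift f v = FreeGroup.lift g v := by
  induction v using FreeGroup.induction_on with
  | C1 => exact ⟨∅, Set.finite_empty, by simp⟩
  | of x => exact ⟨{x}, Set.finite_singleton x, by simp⟩
  | inv_of x ih =>
    obtain ⟨L, hL, h⟩ := ih
    exact ⟨L, hL, fun f g hfg => by rw [map_inv, map_inv, h f g hfg]⟩
  | mul a b iha ihb =>
    obtain ⟨L, hL, h⟩ := iha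
    obtain ⟨M, hM, h'⟩ := ihb
    refine ⟨L ∪ M, hL.union hM, fun f g hfg => ?_⟩
    rw [map_mul, map_mul, h f g fun x hx => hfg x (Or.inl hx),
      h' f g fun x hx => hfg x (Or.inr hx)]

theorem lift_map_eq {Y H : Type*} [Group H] (e : X → Y) (f : Y → H) (v : FreeGroup X) :
    FreeGroup.lift f (FreeGroup.map e v) = FreeGroup.lift (fun x => f (e x)) v := by
  have : (FreeGroup.lift f).comp (FreeGroup.map e) = FreeGroup.lift fun x => f (e x) := by
    ext x
    simp
  exact DFunLike.congr_fun this v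

variable [V.Normal]

theorem map_mk_eq_lift {H : Type*} [Group H] (φ : FreeGroup X ⧸ V →* H) (v : FreeGroup X) :
    φ (v : FreeGroup X ⧸ V) = FreeGroup.lift (fun x => φ (genBar V x)) v := by
  have : φ.comp (QuotientGroup.mk' V) = FreeGroup.lift fun x => φ (genBar V x) := by
    ext x
    simp [genBar]
  exact DFunLike.congr_fun this v

theorem hom_ext_genBar {H : Type*} [Group H] {φ ψ : FreeGroup X ⧸ V →* H}
    (h : ∀ x, φ (genBar V x) = ψ (genBar V x)) : φ = ψ := by
  ext x
  exact h x

theorem exists_finite_hom_congr {H : Type*} [Group H] (g : FreeGroup X ⧸ V) :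
    ∃ L : Set X, L.Finite ∧ ∀ φ ψ : FreeGroup X ⧸ V →* H,
      (∀ x ∈ L, φ (genBar V x) = ψ (genBar V x)) → φ g = ψ g := by
  obtain ⟨v, rfl⟩ := QuotientGroup.mk_surjective g
  obtain ⟨L, hL, h⟩ := exists_finite_lift_congr (H := H) v
  refine ⟨L, hL, fun φ ψ hφ => ?_⟩
  rw [map_mk_eq_lift, map_mk_eq_lift]
  exact h _ _ hφ

theorem exists_endomorphism (hV : ∀ f : FreeGroup X →* FreeGroup X, V.map f ≤ V)
    (f : X → FreeGroup X ⧸ V) :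
    ∃ φ : FreeGroup X ⧸ V →* FreeGroup X ⧸ V, ∀ x, φ (genBar V x) = f x := by
  choose f' hf' using fun x => QuotientGroup.mk_surjective (f x)
  refine ⟨QuotientGroup.map V V (FreeGroup.lift f')
    (Subgroup.map_le_iff_le_comap.1 (hV _)), fun x => ?_⟩
  simp [genBar, hf']

theorem exists_automorphism (hV : ∀ f : FreeGroup X →* FreeGroup X, V.map f ≤ V)
    (f g : X → FreeGroup X ⧸ V)
    (hfg : ∀ φ ψ : FreeGroup X ⧸ V →* FreeGroup X ⧸ V, (∀ x, φ (genBar V x) = f x) →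
      (∀ x, ψ (genBar V x) = g x) → ∀ x, φ (g x) = genBar V x ∧ ψ (f x) = genBar V x) :
    ∃ τ : MulAut (FreeGroup X ⧸ V), ∀ x, τ (genBar V x) = f x := by
  obtain ⟨φ, hφ⟩ := exists_endomorphism hV f
  obtain ⟨ψ, hψ⟩ := exists_endomorphism hV g
  have h := hfg φ ψ hφ hψ
  refine ⟨MonoidHom.toMulEquiv φ ψ (hom_ext_genBar fun x => ?_) (hom_ext_genBar fun x => ?_), hφ⟩
  · simp [hφ, (h x).2]
  · simp [hψ, (h x).1]

theorem exists_perm_automorphism (hV : ∀ f : FreeGroup X →* FreeGroup X, V.map f ≤ V)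
    (p : Equiv.Perm X) :
    ∃ τ : MulAut (FreeGroup X ⧸ V), ∀ x, τ (genBar V x) = genBar V (p x) :=
  exists_automorphism hV _ (fun x => genBar V (p.symm x)) fun φ ψ hφ hψ x => by simp [hφ, hψ]

open Classical in
theorem exists_transvection (hV : ∀ f : FreeGroup X →* FreeGroup X, V.map f ≤ V)
    (y : X) (A : Set X) (hy : y ∉ A) :
    ∃ τ : MulAut (FreeGroup X ⧸ V), (∀ x ∈ A, τ (genBar V x) = genBar V x * genBar V y) ∧
      ∀ x ∉ A, τ (genBar V x) = genBar V x := by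
  obtain ⟨τ, hτ⟩ := exists_automorphism hV
    (fun x => if x ∈ A then genBar V x * genBar V y else genBar V x)
    (fun x => if x ∈ A then genBar V x * (genBar V y)⁻¹ else genBar V x)
    fun φ ψ hφ hψ x => by by_cases hx : x ∈ A <;> simp [hφ, hψ, hx, hy]
  exact ⟨τ, fun x hx => by simp [hτ, hx], fun x hx => by simp [hτ, hx]⟩

/-- A word which is additive on two fresh generators is additive on the whole group. -/
theorem wordEval_mul_of_fresh (hV : ∀ f : FreeGroup X →* FreeGroup X, V.map f ≤ V)
    {s : ℕ} (t : Fin s → X) (w : FreeGroup (Option (Fin s))) {x y : X} (hxy : x ≠ y)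
    (hx : ∀ i, t i ≠ x) (hy : ∀ i, t i ≠ y)
    (h : wordEval w (genBar V x * genBar V y) (fun i => genBar V (t i)) =
      wordEval w (genBar V x) (fun i => genBar V (t i)) *
        wordEval w (genBar V y) (fun i => genBar V (t i)))
    (a b : FreeGroup X ⧸ V) :
    wordEval w (a * b) (fun i => genBar V (t i)) =
      wordEval w a (fun i => genBar V (t i)) * wordEval w b (fun i => genBar V (t i)) := by
  classical
  obtain ⟨φ, hφ⟩ := exists_endomorphism hV
    (fun z => if z = x then a else if z = y then b else genBar V z)
  have := congrArg φ h
  simpa [map_wordEval, hφ, hx, hy, hxy.symm] using this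

/-- If an automorphism is given on the generators by an additive word, then it is given by
this word everywhere. -/
theorem eq_wordEval_of_mul {s : ℕ} (u : Fin s → FreeGroup X ⧸ V)
    (w : FreeGroup (Option (Fin s)))
    (hmul : ∀ a b, wordEval w (a * b) u = wordEval w a u * wordEval w b u)
    (σ : MulAut (FreeGroup X ⧸ V)) (hσ : ∀ x, σ (genBar V x) = wordEval w (genBar V x) u)
    (g : FreeGroup X ⧸ V) : σ g = wordEval w g u := by
  let ω : FreeGroup X ⧸ V →* FreeGroup X ⧸ V := MonoidHom.mk' (fun a => wordEval w a u) hmul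
  have : (σ : FreeGroup X ⧸ V ≃* FreeGroup X ⧸ V).toMonoidHom = ω := hom_ext_genBar hσ
  exact DFunLike.congr_fun this g

end RelativelyFree

theorem card_conj_le_of_eq_wordEval {G : Type*} [Group G] {κ : Cardinal} (hκ : ℵ₀ ≤ κ)
    (hG : #G ≤ κ) (σ : MulAut G) {s : ℕ} (u : Fin s → G) (w : FreeGroup (Option (Fin s)))
    (h : ∀ g, σ g = wordEval w g u) : #{τ : MulAut G | IsConj σ τ} ≤ κ := by
  choose π hπ using fun τ : {τ : MulAut G | IsConj σ τ} => isConj_iff.1 τ.2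
  have hval : ∀ (τ : {τ : MulAut G | IsConj σ τ}) (g : G),
      (τ : MulAut G) g = wordEval w g (fun i => π τ (u i)) := fun τ g => by
    have := map_wordEval (π τ).toMonoidHom w ((π τ)⁻¹ g) u
    rw [← h] at this
    rw [← hπ τ]
    simpa using this
  have hinj : Function.Injective fun (τ : {τ : MulAut G | IsConj σ τ}) (i : Fin s) =>
      π τ (u i) := fun τ τ' hτ => by
    refine Subtype.ext (MulEquiv.ext fun g => ?_)
    rw [hval, hval]
    exact congrArg (wordEval w g) hτ
  calc #{τ : MulAut G | IsConj σ τ} ≤ #(Fin s → G) := mk_le_of_injective hinj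
    _ = #G ^ s := by simp
    _ ≤ κ ^ s := pow_le_pow_left' hG s
    _ ≤ κ := power_nat_le hκ

/-- A family of group elements indexed by the subsets of `ι` in which no two members differ
by an element of the centralizer of `σ` forces the conjugacy class of `σ` to be large. -/
theorem card_lt_card_conj.{u} {G ι : Type u} [Group G] (σ : MulAut G) (τ : Set ι → MulAut G)
    (H : ∀ A B, A ≠ B →
      (∃ g, (τ B)⁻¹ (τ A (σ g)) ≠ σ ((τ B)⁻¹ (τ A g))) ∨
      (∃ g, (τ A)⁻¹ (τ B (σ g)) ≠ σ ((τ A)⁻¹ (τ B g)))) :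
    #ι < #{τ : MulAut G | IsConj σ τ} := by
  have key : ∀ A B, τ A * σ * (τ A)⁻¹ = τ B * σ * (τ B)⁻¹ → ∀ g,
      (τ B)⁻¹ (τ A (σ g)) = σ ((τ B)⁻¹ (τ A g)) := fun A B hAB g => by
    have h : (τ B)⁻¹ * τ A * σ = σ * ((τ B)⁻¹ * τ A) := by
      calc (τ B)⁻¹ * τ A * σ = (τ B)⁻¹ * (τ A * σ * (τ A)⁻¹) * τ A := by group
        _ = σ * ((τ B)⁻¹ * τ A) := by rw [hAB]; group
    exact DFunLike.congr_fun h g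
  have hinj : Function.Injective fun A : Set ι =>
      (⟨τ A * σ * (τ A)⁻¹, isConj_iff.2 ⟨τ A, rfl⟩⟩ : {τ : MulAut G | IsConj σ τ}) := by
    intro A B hAB
    have hAB' := congrArg Subtype.val hAB
    by_contra hne
    rcases H A B hne with ⟨g, hg⟩ | ⟨g, hg⟩
    · exact hg (key A B hAB' g)
    · exact hg (key B A hAB'.symm g)
  refine lt_of_lt_of_le ?_ (mk_le_of_injective hinj)
  rw [mk_set]
  exact cantor _

theorem exists_sequence_avoiding {X T : Type*} {κ : Cardinal} (hκ : ℵ₀ ≤ κ)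
    {W : T → Set X} (hW : ∀ t, (W t).Finite) {P : T → Set X → Prop}
    (h : ∀ U : Set X, #U < κ → ∃ t, P t U) :
    ∃ f : κ.ord.ToType → T, ∀ α, P (f α) (⋃ β ∈ Set.Iio α, W (f β)) := by
  have hT : Nonempty T := ⟨(h ∅ (by simpa using lt_of_lt_of_le aleph0_pos hκ)).choose⟩
  choose! c hc using h
  let wf : WellFounded ((· < ·) : κ.ord.ToType → κ.ord.ToType → Prop) := wellFounded_lt
  let F : (α : κ.ord.ToType) → ((β : κ.ord.ToType) → β < α → T) → T :=
    fun α ih => c (⋃ β : Set.Iio α, W (ih β β.2))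
  have hF : ∀ α, wf.fix F α = c (⋃ β ∈ Set.Iio α, W (wf.fix F β)) := fun α => by
    rw [wf.fix_eq, Set.biUnion_eq_iUnion]
  refine ⟨wf.fix F, fun α => ?_⟩
  have := hc (⋃ β ∈ Set.Iio α, W (wf.fix F β)) ?_
  · rwa [hF]
  have hα : #(Set.Iio α) < κ := by simpa using mk_Iio_lt α (by simp)
  rcases (Set.Iio α).finite_or_infinite with hfin | hinf
  · exact lt_of_lt_of_le (lt_aleph0_iff_set_finite.2 (hfin.biUnion fun β _ => hW _)) hκ
  · have : Infinite (Set.Iio α) := hinf.to_subtype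
    have hle : #(⋃ β ∈ Set.Iio α, W (wf.fix F β)) ≤ #(Set.Iio α) * ℵ₀ :=
      (mk_biUnion_le _ _).trans <| mul_le_mul' le_rfl <|
        ciSup_le' fun β => (lt_aleph0_iff_set_finite.2 (hW _)).le
    exact (hle.trans (mul_aleph0_eq (aleph0_le_mk _)).le).trans_lt hα

open Classical in
/-- The permutation of `ι × Bool` flipping the second coordinate over the set `A`. -/
noncomputable def flipOn {ι : Type*} (A : Set ι) : Equiv.Perm (ι × Bool) :=
  Function.Involutive.toPerm (fun q => (q.1, if q.1 ∈ A then !q.2 else q.2)) fun q => by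
    by_cases h : q.1 ∈ A <;> simp [h]

theorem flipOn_of_mem {ι : Type*} {A : Set ι} {i : ι} (h : i ∈ A) (b : Bool) :
    flipOn A (i, b) = (i, !b) :=
  Prod.ext rfl (if_pos h)

theorem flipOn_of_notMem {ι : Type*} {A : Set ι} {i : ι} (h : i ∉ A) (b : Bool) :
    flipOn A (i, b) = (i, b) :=
  Prod.ext rfl (if_neg h)

section SmallClass

variable {X : Type*} [Infinite X] {V : Subgroup (FreeGroup X)} [V.Normal]

theorem exists_small_set_swap_commute
    {ρ : Equiv.Perm X → MulAut (FreeGroup X ⧸ V)}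
    (hρ : ∀ p x, ρ p (genBar V x) = genBar V (p x))
    {σ : MulAut (FreeGroup X ⧸ V)} (hσ : #{τ : MulAut (FreeGroup X ⧸ V) | IsConj σ τ} ≤ #X)
    [DecidableEq X] :
    ∃ U : Set X, #U < #X ∧ ∀ a ∉ U, ∀ b ∉ U, ∀ x,
      ρ (Equiv.swap a b) (σ (genBar V x)) = σ (genBar V (Equiv.swap a b x)) := by
  by_contra! hcon
  choose L hL hLs using fun x =>
    exists_finite_hom_congr (H := FreeGroup X ⧸ V) (σ (genBar V x))
  let W : X × X × X → Set X := fun t => {t.1, t.2.1, t.2.2} ∪ L t.2.2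
  have hW : ∀ t, (W t).Finite := fun t => (Set.toFinite _).union (hL _)
  obtain ⟨f, hf⟩ := exists_sequence_avoiding (κ := #X) (aleph0_le_mk X) hW
    (P := fun t U => t.1 ∉ U ∧ t.2.1 ∉ U ∧
      ρ (Equiv.swap t.1 t.2.1) (σ (genBar V t.2.2)) ≠
        σ (genBar V (Equiv.swap t.1 t.2.1 t.2.2)))
    (fun U hU => by
      obtain ⟨a, ha, b, hb, x, hx⟩ := hcon U hU
      exact ⟨(a, b, x), ha, hb, hx⟩)
  let e : (#X).ord.ToType × Bool → X := fun q => cond q.2 (f q.1).1 (f q.1).2.1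
  have heW : ∀ α b, e (α, b) ∈ W (f α) := by
    intro α b
    cases b <;> simp [e, W]
  have heN : ∀ α β b, β < α → e (α, b) ∉ W (f β) := by
    intro α β b hβ hmem
    have : e (α, b) ∈ ⋃ β ∈ Set.Iio α, W (f β) := Set.mem_biUnion (Set.mem_Iio.2 hβ) hmem
    cases b
    · exact (hf α).2.1 this
    · exact (hf α).1 this
  have hne : ∀ α, (f α).1 ≠ (f α).2.1 := by
    intro α h
    apply (hf α).2.2
    rw [h, Equiv.swap_self]
    have : (ρ (Equiv.refl X)).toMonoidHom = MonoidHom.id _ := hom_ext_genBar fun x => by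
      simp [hρ]
    exact DFunLike.congr_fun this _
  have heinj : Function.Injective e := by
    rintro ⟨α, b⟩ ⟨β, c⟩ h
    rcases lt_trichotomy α β with hlt | rfl | hlt
    · exact absurd (h ▸ heW α b) (heN β α c hlt)
    · cases b <;> cases c <;> simp_all [e, (hne α).symm]
    · exact absurd (h ▸ heW β c) (heN α β b hlt)
  let p : Set (#X).ord.ToType → Equiv.Perm X := fun A => (flipOn A).viaEmbedding ⟨e, heinj⟩
  have hpe : ∀ A q, p A (e q) = e (flipOn A q) := fun A q =>
    Equiv.Perm.viaEmbedding_apply _ ⟨e, heinj⟩ q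
  have hpn : ∀ A x, x ∉ Set.range e → p A x = x := fun A x hx =>
    Equiv.Perm.viaEmbedding_apply_of_notMem _ ⟨e, heinj⟩ x hx
  have hswap : ∀ α b, Equiv.swap (f α).1 (f α).2.1 (e (α, b)) = e (α, !b) := by
    intro α b
    cases b <;> simp [e]
  have hswap' : ∀ α x, (∀ b, x ≠ e (α, b)) → Equiv.swap (f α).1 (f α).2.1 x = x :=
    fun α x hx => Equiv.swap_apply_of_ne_of_ne (hx true) (hx false)
  have hlt := card_lt_card_conj σ (fun A => ρ (p A)) fun A B hAB => ?_
  · simp only [mk_ord_toType] at hlt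
    exact absurd hσ (not_le.2 hlt)
  have hD : {α | ¬ (α ∈ A ↔ α ∈ B)}.Nonempty := by
    by_contra h
    refine hAB (Set.ext fun α => ?_)
    by_contra hα
    exact h ⟨α, hα⟩
  obtain ⟨α, hα, hmin⟩ := WellFounded.has_min (wellFounded_lt (α := (#X).ord.ToType)) _ hD
  have hmin' : ∀ β < α, (β ∈ A ↔ β ∈ B) := fun β hβ => by
    by_contra h
    exact hmin β h hβ
  have hp : ∀ z ∈ W (f α), p A z = p B (Equiv.swap (f α).1 (f α).2.1 z) := by
    intro z hz
    by_cases hr : z ∈ Set.range e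
    · obtain ⟨⟨β, b⟩, rfl⟩ := hr
      rcases lt_trichotomy β α with hβ | rfl | hβ
      · rw [hswap' α _ fun c h => hβ.ne (congrArg Prod.fst (heinj h)), hpe, hpe]
        by_cases hA : β ∈ A
        · rw [flipOn_of_mem hA, flipOn_of_mem ((hmin' β hβ).1 hA)]
        · rw [flipOn_of_notMem hA, flipOn_of_notMem fun h => hA ((hmin' β hβ).2 h)]
      · rw [hswap, hpe, hpe]
        have hα' : ¬ (β ∈ A ↔ β ∈ B) := hα
        by_cases hA : β ∈ A
        · rw [flipOn_of_mem hA, flipOn_of_notMem fun hB => hα' (iff_of_true hA hB)]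
        · rw [flipOn_of_notMem hA, flipOn_of_mem (by_contra fun hB => hα' (iff_of_false hA hB)),
            Bool.not_not]
      · exact absurd hz (heN β α b hβ)
    · rw [hswap' α z fun b h => hr ⟨_, h.symm⟩, hpn A z hr, hpn B z hr]
  set t := Equiv.swap (f α).1 (f α).2.1 with ht
  refine Or.inl ⟨genBar V (f α).2.2, ?_⟩
  have h1 : ρ (p A) (σ (genBar V (f α).2.2)) = ρ (p B) (ρ t (σ (genBar V (f α).2.2))) :=
    hLs (f α).2.2 (ρ (p A)).toMonoidHom ((ρ (p B)).toMonoidHom.comp (ρ t).toMonoidHom)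
      fun z hz => by simp [hρ, hp z (Or.inr hz)]
  have h2 : ρ (p A) (genBar V (f α).2.2) = ρ (p B) (genBar V (t (f α).2.2)) := by
    rw [hρ, hρ, hp _ (by simp [W])]
  rw [h1, h2, MulAut.inv_apply_self, MulAut.inv_apply_self]
  exact (hf α).2.2

/-- An automorphism with small conjugacy class is given by a single word on a large set of
generators disjoint from the parameters of the word. -/
theorem exists_word_on_large_set
    (hV : ∀ f : FreeGroup X →* FreeGroup X, V.map f ≤ V)
    {σ : MulAut (FreeGroup X ⧸ V)}
    (hσ : #{τ : MulAut (FreeGroup X ⧸ V) | IsConj σ τ} ≤ #X) :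
    ∃ (s : ℕ) (t : Fin s → X) (w : FreeGroup (Option (Fin s))) (Y : Set X),
      #(Yᶜ : Set X) < #X ∧ (∀ i, t i ∉ Y) ∧
      ∀ y ∈ Y, σ (genBar V y) = wordEval w (genBar V y) fun i => genBar V (t i) := by
  classical
  choose ρ hρ using exists_perm_automorphism hV
  obtain ⟨U, hU, hcomm⟩ := exists_small_set_swap_commute hρ hσ
  obtain ⟨x₀, hx₀⟩ : ∃ x, x ∉ U := by
    by_contra! h
    rw [Set.eq_univ_of_forall h, mk_univ] at hU
    exact hU.false
  obtain ⟨v, hv⟩ := QuotientGroup.mk_surjective (σ (genBar V x₀))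
  obtain ⟨L, hL, hLv⟩ := exists_finite_lift_congr (H := FreeGroup X ⧸ V) v
  have hfin : Finite (L \ {x₀} : Set X) := (hL.subset Set.sdiff_subset).to_subtype
  obtain ⟨s, ⟨E⟩⟩ := Finite.exists_equiv_fin (L \ {x₀} : Set X)
  let enc : X → Option (Fin s) := fun x =>
    if h : x ∈ (L \ {x₀} : Set X) then some (E ⟨x, h⟩) else none
  refine ⟨s, fun i => E.symm i, FreeGroup.map enc v, (U ∪ L)ᶜ, ?_, fun i hi => ?_, ?_⟩
  · rw [compl_compl]
    exact (mk_union_le U L).trans_lt (add_lt_of_lt (aleph0_le_mk X) hU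
      (lt_of_lt_of_le (lt_aleph0_iff_set_finite.2 hL) (aleph0_le_mk X)))
  · exact hi (Or.inr (E.symm i).2.1)
  · intro y hy
    have hyU : y ∉ U := fun h => hy (Or.inl h)
    have hyL : y ∉ L := fun h => hy (Or.inr h)
    have h := hcomm x₀ hx₀ y hyU x₀
    rw [Equiv.swap_apply_left] at h
    rw [← h, ← hv, wordEval, lift_map_eq]
    refine (map_mk_eq_lift (ρ (Equiv.swap x₀ y)).toMonoidHom v).trans (hLv _ _ fun x hx => ?_)
    have hxy : x ≠ y := fun h => hyL (h ▸ hx)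
    by_cases hxx : x = x₀
    · subst hxx
      simp [enc, hρ]
    · simp [enc, hρ, hx, hxx, Equiv.swap_apply_of_ne_of_ne hxx hxy]

theorem exists_mem_wordEval_mul
    (hV : ∀ f : FreeGroup X →* FreeGroup X, V.map f ≤ V)
    {σ : MulAut (FreeGroup X ⧸ V)}
    (hσ : #{τ : MulAut (FreeGroup X ⧸ V) | IsConj σ τ} ≤ #X)
    {s : ℕ} {t : Fin s → X} {w : FreeGroup (Option (Fin s))} {Y : Set X}
    (hY : #(Yᶜ : Set X) < #X) (htY : ∀ i, t i ∉ Y)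
    (hw : ∀ y ∈ Y, σ (genBar V y) = wordEval w (genBar V y) fun i => genBar V (t i)) (y : X) :
    ∃ x ∈ Y, x ≠ y ∧ wordEval w (genBar V x * genBar V y) (fun i => genBar V (t i)) =
      wordEval w (genBar V x) (fun i => genBar V (t i)) * σ (genBar V y) := by
  by_contra! hcon
  have hy : ∀ A : Set (Y \ {y} : Set X), y ∉ Subtype.val '' A := by
    rintro A ⟨z, -, hz⟩
    exact z.2.2 hz
  choose τ hτ hτ' using fun A : Set (Y \ {y} : Set X) =>
    exists_transvection hV y (Subtype.val '' A) (hy A)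
  have hfix : ∀ A z, z ∉ Subtype.val '' A → (τ A)⁻¹ (genBar V z) = genBar V z := by
    intro A z hz
    nth_rw 1 [← hτ' A z hz]
    exact MulAut.inv_apply_self _ _ _
  have ht : ∀ A i, t i ∉ Subtype.val '' (A : Set (Y \ {y} : Set X)) := by
    rintro A i ⟨z, -, hz⟩
    exact htY i (hz ▸ z.2.1)
  have key : ∀ (A B : Set (Y \ {y} : Set X)), ∀ x ∈ A, x ∉ B →
      (τ B)⁻¹ (τ A (σ (genBar V x))) ≠ σ ((τ B)⁻¹ (τ A (genBar V x))) := by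
    intro A B x hA hB
    have hxA : (x : X) ∈ Subtype.val '' A := ⟨x, hA, rfl⟩
    have hxB : (x : X) ∉ Subtype.val '' B := fun ⟨z, hz, hzx⟩ => hB (Subtype.ext hzx ▸ hz)
    have hB' := map_wordEval ((τ B)⁻¹ : MulAut _).toMonoidHom w
      (genBar V x * genBar V y) fun i => genBar V (t i)
    have hA' := map_wordEval (τ A).toMonoidHom w (genBar V x) fun i => genBar V (t i)
    simp only [MulEquiv.toMonoidHom_eq_coe, MonoidHom.coe_coe, map_mul, hfix B _ hxB,
      hfix B y (hy B), hfix B _ (ht B _), hτ A _ hxA, hτ' A _ (ht A _)] at hA' hB'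
    rw [hw x x.2.1, hA', hB', hτ A _ hxA, map_mul, hfix B _ hxB, hfix B y (hy B), map_mul,
      hw x x.2.1]
    exact hcon x x.2.1 x.2.2
  have hlt := card_lt_card_conj σ τ fun A B hAB => ?_
  · have hc : #(Y \ {y} : Set X) = #X := by
      have : (Y \ {y} : Set X) = (Yᶜ ∪ {y})ᶜ := by
        ext
        simp [and_comm]
      rw [this]
      refine mk_compl_of_infinite _ ((mk_union_le _ _).trans_lt
        (add_lt_of_lt (aleph0_le_mk X) hY ?_))
      rw [mk_singleton]
      exact one_lt_aleph0.trans_le (aleph0_le_mk X)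
    simp only [hc] at hlt
    exact absurd hσ (not_le.2 hlt)
  by_cases hsub : A ⊆ B
  · obtain ⟨x, hxB, hxA⟩ := Set.not_subset.1 fun h => hAB (hsub.antisymm h)
    exact Or.inr ⟨_, key B A x hxB hxA⟩
  · obtain ⟨x, hxA, hxB⟩ := Set.not_subset.1 hsub
    exact Or.inl ⟨_, key A B x hxA hxB⟩

end SmallClass

/-- Let `G = FreeGroup X ⧸ V` be a relatively free group of infinite rank `κ = #X`
(`V` fully invariant), with basis `X̄`.  The conjugacy class of `σ ∈ Aut G` is small
(of cardinality at most `κ`) iff there are `u₁, …, u_s ∈ X̄` and a group word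
`w(*;*₁,…,*_s)` such that `σ x = w(x;u₁,…,u_s)` for all `x ∈ X̄` and
`w(xy;ū) = w(x;ū)·w(y;ū)` for all `x, y ∈ X̄`. -/
theorem small_conjugacy_class_iff_word
    {X : Type*} [Infinite X] (V : Subgroup (FreeGroup X)) [V.Normal]
    (hV : ∀ f : FreeGroup X →* FreeGroup X, V.map f ≤ V)
    (σ : MulAut (FreeGroup X ⧸ V)) :
    Cardinal.mk {τ : MulAut (FreeGroup X ⧸ V) | IsConj σ τ} ≤ Cardinal.mk X ↔
      ∃ (s : ℕ) (u : Fin s → FreeGroup X ⧸ V) (w : FreeGroup (Option (Fin s))),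
        (∀ i : Fin s, u i ∈ genBasis V) ∧
        (∀ x ∈ genBasis V, σ x = wordEval w x u) ∧
        (∀ x ∈ genBasis V, ∀ y ∈ genBasis V,
          wordEval w (x * y) u = wordEval w x u * wordEval w y u) := by
  constructor
  · intro hσ
    obtain ⟨s, t, w, Y, hY, htY, hw⟩ := exists_word_on_large_set hV hσ
    have hmem := exists_mem_wordEval_mul hV hσ hY htY hw
    obtain ⟨y, hy, -⟩ := hmem (Classical.arbitrary X)
    obtain ⟨x, hx, hxy, hxy'⟩ := hmem y
    rw [hw y hy] at hxy'
    have hmul := wordEval_mul_of_fresh hV t w hxy (fun i h => htY i (h ▸ hx))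
      (fun i h => htY i (h ▸ hy)) hxy'
    refine ⟨s, fun i => genBar V (t i), w, fun i => ⟨t i, rfl⟩, ?_, fun a _ b _ => hmul a b⟩
    rintro _ ⟨z, rfl⟩
    obtain ⟨x', -, -, h⟩ := hmem z
    rw [hmul] at h
    exact (mul_left_cancel h).symm
  · rintro ⟨s, u, w, hu, hw, hmul⟩
    choose t ht using hu
    obtain rfl : (fun i => genBar V (t i)) = u := funext ht
    have hinf := (Set.finite_range t).infinite_compl
    obtain ⟨x, hx⟩ := hinf.nonempty
    obtain ⟨y, hy, hyx⟩ := hinf.exists_notMem_finite (Set.finite_singleton x)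
    have hmul' := wordEval_mul_of_fresh hV t w (fun h => hyx h.symm) (fun i h => hx ⟨i, h⟩)
      (fun i h => hy ⟨i, h⟩) (hmul _ ⟨x, rfl⟩ _ ⟨y, rfl⟩)
    have hG : #(FreeGroup X ⧸ V) ≤ #X := by
      refine (mk_le_of_surjective QuotientGroup.mk_surjective).trans ?_
      rw [mk_freeGroup, max_eq_left (aleph0_le_mk X)]
    exact card_conj_le_of_eq_wordEval (aleph0_le_mk X) hG σ _ w
      (eq_wordEval_of_mul _ w hmul' σ fun x => hw _ ⟨x, rfl⟩)
end

section
/- Let G be a centerless relatively free group of infinite rank κ, formalized as G = FreeGroup X ⧸ V with X infinite, V fully invariant, and the center of G trivial, and let Γ = Aut G. If the cardinality of the conjugacy class ρ^Γ of some ρ ∈ Γ is strictly less than κ = #X, then ρ is the identity automorphism. -/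
open Cardinal

universe u

namespace RelativelyFree

variable {X : Type*} {V : Subgroup (FreeGroup X)} [V.Normal]

/-- The image of a free generator in the relatively free group. -/
def gen (V : Subgroup (FreeGroup X)) [V.Normal] (i : X) : FreeGroup X ⧸ V :=
  QuotientGroup.mk (FreeGroup.of i)

theorem hom_ext {H : Type*} [Group H] {φ ψ : FreeGroup X ⧸ V →* H}
    (h : ∀ i, φ (gen V i) = ψ (gen V i)) : φ = ψ := by
  apply QuotientGroup.monoidHom_ext
  apply FreeGroup.ext_hom
  exact h

theorem lift_eq_one_of_mem (hV : ∀ f : FreeGroup X →* FreeGroup X, V.map f ≤ V)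
    (f : X → FreeGroup X ⧸ V) {v : FreeGroup X} (hv : v ∈ V) : FreeGroup.lift f v = 1 := by
  have hf : FreeGroup.lift f =
      (QuotientGroup.mk' V).comp (FreeGroup.lift fun i => (f i).out) := by
    ext i
    simp
  rw [hf, MonoidHom.comp_apply, QuotientGroup.mk'_apply, QuotientGroup.eq_one_iff]
  exact hV _ ⟨v, hv, rfl⟩

/-- The endomorphism of the relatively free group with prescribed values on generators. -/
def endo (hV : ∀ f : FreeGroup X →* FreeGroup X, V.map f ≤ V) (f : X → FreeGroup X ⧸ V) :
    FreeGroup X ⧸ V →* FreeGroup X ⧸ V :=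
  QuotientGroup.lift V (FreeGroup.lift f) fun _ hv => lift_eq_one_of_mem hV f hv

variable (hV : ∀ f : FreeGroup X →* FreeGroup X, V.map f ≤ V)

@[simp]
theorem endo_gen (f : X → FreeGroup X ⧸ V) (i : X) : endo hV f (gen V i) = f i := by
  exact FreeGroup.lift_apply_of

theorem endo_gen_self : endo hV (gen V) = MonoidHom.id _ :=
  hom_ext fun i => by simp

/-- Every element involves only finitely many generators. -/
theorem exists_finset_support (w : FreeGroup X ⧸ V) :
    ∃ S : Finset X, ∀ f g : X → FreeGroup X ⧸ V,
      (∀ i ∈ S, f i = g i) → endo hV f w = endo hV g w := by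
  classical
  obtain ⟨w, rfl⟩ := QuotientGroup.mk_surjective w
  induction w using FreeGroup.induction_on with
  | C1 => exact ⟨∅, fun f g _ => by simp⟩
  | of i => exact ⟨{i}, fun f g h => by
      change endo hV f (gen V i) = endo hV g (gen V i)
      simpa using h i (by simp)⟩
  | inv_of i _ => exact ⟨{i}, fun f g h => by
      change endo hV f (gen V i)⁻¹ = endo hV g (gen V i)⁻¹
      simpa using h i (by simp)⟩
  | mul a b ha hb =>
    obtain ⟨S, hS⟩ := ha
    obtain ⟨T, hT⟩ := hb
    refine ⟨S ∪ T, fun f g h => ?_⟩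
    rw [QuotientGroup.mk_mul, map_mul, map_mul,
      hS f g fun i hi => h i (Finset.mem_union_left _ hi),
      hT f g fun i hi => h i (Finset.mem_union_right _ hi)]

/-- The automorphism multiplying the generator `x` on the right by another generator `y`. -/
def transvection [DecidableEq X] {x y : X} (hxy : y ≠ x) : MulAut (FreeGroup X ⧸ V) :=
  MonoidHom.toMulEquiv
    (endo hV (Function.update (gen V) x (gen V x * gen V y)))
    (endo hV (Function.update (gen V) x (gen V x * (gen V y)⁻¹)))
    (hom_ext fun i => by
      by_cases hi : i = x
      · subst hi; simp [hxy]
      · simp [hi])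
    (hom_ext fun i => by
      by_cases hi : i = x
      · subst hi; simp [hxy]
      · simp [hi])

/-- The automorphism inverting the generator `x`. -/
def inversion [DecidableEq X] (x : X) : MulAut (FreeGroup X ⧸ V) :=
  MonoidHom.toMulEquiv
    (endo hV (Function.update (gen V) x (gen V x)⁻¹))
    (endo hV (Function.update (gen V) x (gen V x)⁻¹))
    (hom_ext fun i => by
      by_cases hi : i = x
      · subst hi; simp
      · simp [hi])
    (hom_ext fun i => by
      by_cases hi : i = x
      · subst hi; simp
      · simp [hi])

theorem endo_update_comp_update_one [DecidableEq X] (x : X) (g : FreeGroup X ⧸ V) :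
    (endo hV (Function.update (gen V) x g)).comp (endo hV (Function.update (gen V) x 1)) =
      endo hV (Function.update (gen V) x 1) :=
  hom_ext fun i => by
    by_cases hi : i = x
    · subst hi; simp
    · simp [hi]

/-- If the conjugacy class of `ρ` has fewer than `#X` elements, then any two families of
automorphisms indexed by generators outside a finite set have two indices at which
both families conjugate `ρ` in the same way. -/
theorem exists_ne_commute {G X : Type u} [Group G] [Infinite X] {ρ : G}
    (h : Cardinal.mk {τ : G | IsConj ρ τ} < Cardinal.mk X)
    (S : Finset X) (α β : {y // y ∉ S} → G) :
    ∃ y z, y ≠ z ∧ Commute ((α z)⁻¹ * α y) ρ ∧ Commute ((β z)⁻¹ * β y) ρ := by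
  let F : {y // y ∉ S} → {τ : G | IsConj ρ τ} × {τ : G | IsConj ρ τ} := fun y =>
    (⟨α y * ρ * (α y)⁻¹, isConj_iff.2 ⟨_, rfl⟩⟩, ⟨β y * ρ * (β y)⁻¹, isConj_iff.2 ⟨_, rfl⟩⟩)
  have key : ∀ a b : G, a * ρ * a⁻¹ = b * ρ * b⁻¹ → Commute (b⁻¹ * a) ρ := by
    intro a b hab
    have : a * ρ = b * ρ * b⁻¹ * a := by rw [← hab]; group
    rw [Commute, SemiconjBy, mul_assoc, this]
    group
  have hF : ¬ Function.Injective F := by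
    intro hF
    have hle := Cardinal.mk_le_of_injective hF
    have hS : Cardinal.mk {y // y ∉ S} = Cardinal.mk X := Cardinal.mk_compl_finset_of_infinite S
    rw [hS, Cardinal.mk_prod, Cardinal.lift_id] at hle
    exact hle.not_gt (Cardinal.mul_lt_of_lt (Cardinal.aleph0_le_mk X) h h)
  simp only [Function.Injective, not_forall] at hF
  obtain ⟨y, z, hyz, hne⟩ := hF
  simp only [F, Prod.mk.injEq, Subtype.mk.injEq] at hyz
  exact ⟨y, z, hne, key _ _ hyz.1, key _ _ hyz.2⟩

theorem exists_eq_mul_gen [Infinite X] [DecidableEq X]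
    (hc : Subgroup.center (FreeGroup X ⧸ V) = ⊥) (ρ : MulAut (FreeGroup X ⧸ V))
    (h : Cardinal.mk {τ : MulAut (FreeGroup X ⧸ V) | IsConj ρ τ} < Cardinal.mk X) (x : X) :
    ∃ a, (∀ g, endo hV (Function.update (gen V) x g) a = a) ∧ ρ (gen V x) = a * gen V x := by
  obtain ⟨S, hS⟩ := exists_finset_support hV (ρ (gen V x))
  obtain ⟨⟨y, hy⟩, ⟨z, hz⟩, hne, hinn, htr⟩ := exists_ne_commute h (insert x S)
    (fun y => MulAut.conj (gen V y.1))
    (fun y => transvection hV (x := x) (y := y.1) fun e => y.2 (by simp [e]))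
  simp only [Finset.mem_insert, not_or, ne_eq, Subtype.mk.injEq] at hy hz hne
  obtain ⟨hyx, hyS⟩ := hy
  obtain ⟨hzx, hzS⟩ := hz
  set t := (gen V z)⁻¹ * gen V y with ht
  have hfix : ρ t = t := by
    rw [← map_inv, ← map_mul, ← ht] at hinn
    have hcomm : ∀ g, t * ρ g * t⁻¹ = ρ t * ρ g * (ρ t)⁻¹ := fun g => by
      simpa using DFunLike.congr_fun hinn.eq g
    have hmem : (ρ t)⁻¹ * t ∈ Subgroup.center (FreeGroup X ⧸ V) := by
      rw [Subgroup.mem_center_iff]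
      intro g
      obtain ⟨g, rfl⟩ := ρ.surjective g
      have := hcomm g
      calc ρ g * ((ρ t)⁻¹ * t) = (ρ t)⁻¹ * (ρ t * ρ g * (ρ t)⁻¹) * t := by group
        _ = (ρ t)⁻¹ * t * ρ g := by rw [← this]; group
    rw [hc, Subgroup.mem_bot] at hmem
    exact (inv_mul_eq_one.1 hmem)
  have hθ : endo hV (Function.update (gen V) x (gen V x * t)) (ρ (gen V x)) =
      ρ (gen V x) * t := by
    have hcomp :
        (endo hV (Function.update (gen V) x (gen V x * (gen V z)⁻¹))).comp
          (endo hV (Function.update (gen V) x (gen V x * gen V y))) =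
        endo hV (Function.update (gen V) x (gen V x * t)) := hom_ext fun i => by
      by_cases hi : i = x
      · subst hi; simp [hyx, ht, mul_assoc]
      · simp [hi]
    have h1 := DFunLike.congr_fun htr.eq (gen V x)
    simp only [MulAut.mul_apply] at h1
    have h2 : ∀ g, (transvection hV hzx)⁻¹ (transvection hV hyx g) =
        endo hV (Function.update (gen V) x (gen V x * t)) g :=
      fun g => DFunLike.congr_fun hcomp g
    rw [h2, h2, endo_gen, Function.update_self, map_mul, hfix] at h1
    exact h1
  refine ⟨endo hV (Function.update (gen V) x 1) (ρ (gen V x)), fun g =>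
    DFunLike.congr_fun (endo_update_comp_update_one hV x g) _, ?_⟩
  let f := Function.update (Function.update (Function.update (gen V) x 1) z 1) y (gen V x)
  have h1 := congrArg (endo hV f) hθ
  have hcomp : (endo hV f).comp (endo hV (Function.update (gen V) x (gen V x * t))) =
      endo hV fun i => endo hV f (Function.update (gen V) x (gen V x * t) i) :=
    hom_ext fun i => by simp
  have hf : ∀ i ∈ S, f i = Function.update (gen V) x 1 i := fun i hi => by
    have : i ≠ y := fun e => hyS (e ▸ hi)
    have : i ≠ z := fun e => hzS (e ▸ hi)
    simp [f, *]
  have h2 : endo hV f (endo hV (Function.update (gen V) x (gen V x * t)) (ρ (gen V x))) =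
      ρ (gen V x) := by
    rw [← MonoidHom.comp_apply, hcomp, hS _ (gen V), endo_gen_self, MonoidHom.id_apply]
    intro i hi
    by_cases hix : i = x
    · subst hix
      simp [f, ht, Ne.symm hyx, Ne.symm hzx, Ne.symm hne]
    · rw [Function.update_of_ne hix, endo_gen, hf i hi, Function.update_of_ne hix]
  rw [h2, map_mul, hS _ _ hf] at h1
  nth_rewrite 1 [h1]
  simp [f, ht, Ne.symm hne]

end RelativelyFree

open RelativelyFree in
/-- Let `G = FreeGroup X ⧸ V` be a centerless relatively free group of infinite rank
`κ = #X` (`V` fully invariant).  If the conjugacy class of `ρ ∈ Aut G` has cardinality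
strictly less than `κ`, then `ρ` is the identity. -/
theorem conjugacy_class_lt_rank_eq_one
    {X : Type*} [Infinite X] (V : Subgroup (FreeGroup X)) [V.Normal]
    (hV : ∀ f : FreeGroup X →* FreeGroup X, V.map f ≤ V)
    (hc : Subgroup.center (FreeGroup X ⧸ V) = ⊥)
    (ρ : MulAut (FreeGroup X ⧸ V))
    (h : Cardinal.mk {τ : MulAut (FreeGroup X ⧸ V) | IsConj ρ τ} < Cardinal.mk X) :
    ρ = 1 := by
  classical
  suffices hρ : ρ.toMonoidHom = MonoidHom.id _ from
    MulEquiv.ext fun g => DFunLike.congr_fun hρ g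
  refine hom_ext fun x => ?_
  change ρ (gen V x) = gen V x
  obtain ⟨a, ha, hax⟩ := exists_eq_mul_gen hV hc ρ h x
  let σ : MulAut (FreeGroup X ⧸ V) := inversion hV x
  have hσ : ∀ g, σ g = endo hV (Function.update (gen V) x (gen V x)⁻¹) g := fun _ => rfl
  have hσ' : ∀ g, σ⁻¹ g = endo hV (Function.update (gen V) x (gen V x)⁻¹) g := fun _ => rfl
  have hconj : IsConj ρ (σ * ρ * σ⁻¹) := isConj_iff.2 ⟨σ, rfl⟩
  obtain ⟨b, hb, hbx⟩ := exists_eq_mul_gen hV hc (σ * ρ * σ⁻¹) (by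
    have hset : {τ | IsConj (σ * ρ * σ⁻¹) τ} = {τ | IsConj ρ τ} :=
      Set.ext fun τ => ⟨hconj.trans, hconj.symm.trans⟩
    rwa [hset]) x
  simp only [MulAut.mul_apply] at hbx
  rw [hσ', endo_gen, Function.update_self, map_inv, hax, hσ, map_inv, map_mul, ha, endo_gen,
    Function.update_self, mul_inv_rev, inv_inv] at hbx
  have hab : ∀ g, g * a⁻¹ = b * g := fun g => by
    simpa [ha, hb] using congrArg (endo hV (Function.update (gen V) x g)) hbx
  have hba : a⁻¹ = b := by simpa using hab 1
  have hmem : b ∈ Subgroup.center (FreeGroup X ⧸ V) :=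
    Subgroup.mem_center_iff.2 fun g => by rw [← hab g, hba]
  rw [hc, Subgroup.mem_bot] at hmem
  rw [hax, inv_eq_one.1 (hba.trans hmem), one_mul]
end

section
/- Let G be a nontrivial centerless relatively free group of infinite rank κ, formalized as G = FreeGroup X ⧸ V with X infinite, V a proper fully invariant subgroup, and the center of G trivial, and let Γ = Aut G. Then every nonidentity π ∈ Γ has conjugacy class π^Γ of cardinality at least κ = #X, and there exists a nonidentity π ∈ Γ whose conjugacy class has cardinality exactly κ; that is, the minimum of the cardinalities |π^Γ| over nonidentity π ∈ Γ equals κ. -/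
open Cardinal

namespace MulAut

variable {G : Type*} [Group G]

theorem conj_injective_of_center_eq_bot (hc : Subgroup.center G = ⊥) :
    Function.Injective (MulAut.conj : G →* MulAut G) := by
  rw [injective_iff_map_eq_one]
  intro g hg
  rw [← Subgroup.mem_bot, ← hc, Subgroup.mem_center_iff]
  intro h
  have := DFunLike.congr_fun hg h
  simp only [MulAut.conj_apply, MulAut.one_apply] at this
  exact (mul_inv_eq_iff_eq_mul.mp this).symm

theorem mul_conj_mul_inv (σ : MulAut G) (g : G) :
    σ * MulAut.conj g * σ⁻¹ = MulAut.conj (σ g) := by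
  ext h
  simp

/-- If conjugating `π` by the inner automorphisms of `a` and `b` gives the same result, then
`π` fixes `a⁻¹ * b`. -/
theorem apply_inv_mul_eq_of_conj_eq (hc : Subgroup.center G = ⊥) (π : MulAut G) {a b : G}
    (h : MulAut.conj a * π * (MulAut.conj a)⁻¹ = MulAut.conj b * π * (MulAut.conj b)⁻¹) :
    π (a⁻¹ * b) = a⁻¹ * b := by
  apply conj_injective_of_center_eq_bot hc
  rw [← mul_conj_mul_inv, map_mul, map_inv, mul_inv_eq_iff_eq_mul]
  rw [mul_inv_eq_iff_eq_mul] at h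
  calc π * ((MulAut.conj a)⁻¹ * MulAut.conj b)
      = (MulAut.conj a)⁻¹ * (MulAut.conj a * π) * (MulAut.conj a)⁻¹ * MulAut.conj b := by group
    _ = (MulAut.conj a)⁻¹ * MulAut.conj b * π := by rw [h]; group

/-- The conjugacy class of an inner automorphism is a set of inner automorphisms. -/
theorem mk_setOf_isConj_conj_le (g : G) :
    #{τ : MulAut G | IsConj (MulAut.conj g) τ} ≤ #G := by
  have hsub : {τ : MulAut G | IsConj (MulAut.conj g) τ} ⊆ Set.range MulAut.conj := by
    intro τ hτ
    obtain ⟨σ, rfl⟩ := isConj_iff.mp hτ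
    exact ⟨σ g, (mul_conj_mul_inv σ g).symm⟩
  exact (mk_le_mk_of_subset hsub).trans mk_range_le

end MulAut

namespace FreeGroup

variable {X : Type*}

/-- Every element of a free group involves only finitely many generators. -/
theorem exists_finset_forall_map_eq (w : FreeGroup X) :
    ∃ S : Finset X, ∀ φ : FreeGroup X →* FreeGroup X,
      (∀ y ∈ S, φ (of y) = of y) → φ w = w := by
  classical
  induction w using FreeGroup.induction_on with
  | C1 => exact ⟨∅, fun φ _ => _root_.map_one φ⟩
  | of x => exact ⟨{x}, fun φ h => h x (Finset.mem_singleton_self x)⟩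
  | inv_of x ih =>
    obtain ⟨S, hS⟩ := ih
    exact ⟨S, fun φ h => by rw [_root_.map_inv, hS φ h]⟩
  | mul x y hx hy =>
    obtain ⟨S, hS⟩ := hx
    obtain ⟨T, hT⟩ := hy
    refine ⟨S ∪ T, fun φ h => ?_⟩
    rw [_root_.map_mul, hS φ fun y hy => h y (Finset.mem_union_left T hy),
      hT φ fun y hy => h y (Finset.mem_union_right S hy)]

/-- In a relatively free group, an element commuting with `z⁻¹ * z'` for two distinct generators
`z`, `z'` not occurring in it is central. -/
theorem exists_finset_forall_mem_center (V : Subgroup (FreeGroup X)) [V.Normal]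
    (hV : ∀ f : FreeGroup X →* FreeGroup X, V.map f ≤ V) (t : FreeGroup X ⧸ V) :
    ∃ S : Finset X, ∀ z ∉ S, ∀ z' ∉ S, z ≠ z' →
      Commute ((of z : FreeGroup X ⧸ V)⁻¹ * (of z' : FreeGroup X ⧸ V)) t →
        t ∈ Subgroup.center (FreeGroup X ⧸ V) := by
  classical
  obtain ⟨w, rfl⟩ := QuotientGroup.mk_surjective t
  obtain ⟨S, hS⟩ := exists_finset_forall_map_eq w
  refine ⟨S, fun z hz z' hz' hne hcomm => Subgroup.mem_center_iff.mpr fun g => ?_⟩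
  obtain ⟨a, rfl⟩ := QuotientGroup.mk_surjective g
  let φ : FreeGroup X →* FreeGroup X :=
    lift fun y => if y = z then 1 else if y = z' then a else of y
  have hw : φ w = w := hS φ fun y hy => by
    simp [φ, ne_of_mem_of_not_mem hy hz, ne_of_mem_of_not_mem hy hz']
  have hz1 : φ (of z) = 1 := by simp [φ]
  have hza : φ (of z') = a := by simp [φ, hne.symm]
  have := hcomm.map (QuotientGroup.map V V φ (Subgroup.map_le_iff_le_comap.mp (hV φ)))
  simpa [QuotientGroup.map_mk, hw, hz1, hza] using this.eq

/-- A nonidentity automorphism of a centerless relatively free group of infinite rank has at least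
as many conjugates as the rank. -/
theorem mk_le_mk_setOf_isConj [Infinite X] (V : Subgroup (FreeGroup X)) [V.Normal]
    (hV : ∀ f : FreeGroup X →* FreeGroup X, V.map f ≤ V)
    (hc : Subgroup.center (FreeGroup X ⧸ V) = ⊥)
    {π : MulAut (FreeGroup X ⧸ V)} (hπ : π ≠ 1) :
    #X ≤ #{τ : MulAut (FreeGroup X ⧸ V) | IsConj π τ} := by
  by_contra! hlt
  obtain ⟨k, hk⟩ : ∃ k, π k ≠ k := by
    by_contra! h
    exact hπ (MulEquiv.ext h)
  obtain ⟨S, hS⟩ := exists_finset_forall_mem_center V hV (π k * k⁻¹)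
  let C := {τ : MulAut (FreeGroup X ⧸ V) | IsConj π τ}
  let c (g : FreeGroup X ⧸ V) : C :=
    ⟨MulAut.conj g * π * (MulAut.conj g)⁻¹, isConj_iff.mpr ⟨MulAut.conj g, rfl⟩⟩
  let F (z : ((S : Set X)ᶜ : Set X)) : C × C :=
    (c (of z.1 : FreeGroup X), c ((of z.1 : FreeGroup X) * k))
  have hF : ¬ Function.Injective F := by
    intro hinj
    have hcard : #((S : Set X)ᶜ : Set X) = #X :=
      mk_compl_of_infinite _ ((Cardinal.lt_aleph0_of_finite _).trans_le (aleph0_le_mk X))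
    have hle := mk_le_of_injective hinj
    rw [hcard, ← mul_def] at hle
    exact hle.not_gt (mul_lt_of_lt (aleph0_le_mk X) hlt hlt)
  obtain ⟨⟨z, hz⟩, ⟨z', hz'⟩, heq, hne⟩ := Function.not_injective_iff.mp hF
  have h1 := MulAut.apply_inv_mul_eq_of_conj_eq hc π (congrArg (fun p => p.1.1) heq)
  have h2 := MulAut.apply_inv_mul_eq_of_conj_eq hc π (congrArg (fun p => p.2.1) heq)
  refine hk (mul_inv_eq_one.mp ?_)
  rw [← Subgroup.mem_bot, ← hc]
  refine hS z hz z' hz' (fun h => hne (Subtype.ext h)) ?_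
  set h := (of z : FreeGroup X ⧸ V)⁻¹ * (of z' : FreeGroup X ⧸ V) with hh
  have h3 : ((of z : FreeGroup X ⧸ V) * k)⁻¹ * ((of z' : FreeGroup X ⧸ V) * k)
      = k⁻¹ * h * k := by rw [hh]; group
  change π (((of z : FreeGroup X ⧸ V) * k)⁻¹ * ((of z' : FreeGroup X ⧸ V) * k)) =
    ((of z : FreeGroup X ⧸ V) * k)⁻¹ * ((of z' : FreeGroup X ⧸ V) * k) at h2
  change π h = h at h1
  rw [h3, _root_.map_mul, _root_.map_mul, _root_.map_inv, h1] at h2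
  calc h * (π k * k⁻¹) = π k * ((π k)⁻¹ * h * π k) * k⁻¹ := by group
    _ = π k * k⁻¹ * h := by rw [h2]; group

end FreeGroup

/-- Let `G = FreeGroup X ⧸ V` be a nontrivial centerless relatively free group of
infinite rank `κ = #X` (`V` a proper fully invariant subgroup).  Then every nonidentity
`π ∈ Aut G` has conjugacy class of cardinality at least `κ`, and some nonidentity
`π ∈ Aut G` has conjugacy class of cardinality exactly `κ`; i.e. the minimum of the
cardinalities of the conjugacy classes of nonidentity automorphisms equals `κ`. -/
theorem min_conjugacy_class_nonidentity_eq_rank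
    {X : Type*} [Infinite X] (V : Subgroup (FreeGroup X)) [V.Normal]
    (hV : ∀ f : FreeGroup X →* FreeGroup X, V.map f ≤ V)
    (hVproper : V ≠ ⊤)
    (hc : Subgroup.center (FreeGroup X ⧸ V) = ⊥) :
    (∀ π : MulAut (FreeGroup X ⧸ V), π ≠ 1 →
      Cardinal.mk X ≤ Cardinal.mk {τ : MulAut (FreeGroup X ⧸ V) | IsConj π τ}) ∧
    (∃ π : MulAut (FreeGroup X ⧸ V), π ≠ 1 ∧
      Cardinal.mk {τ : MulAut (FreeGroup X ⧸ V) | IsConj π τ} = Cardinal.mk X) := by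
  refine ⟨fun π hπ => FreeGroup.mk_le_mk_setOf_isConj V hV hc hπ, ?_⟩
  obtain ⟨w, hw⟩ : ∃ w, w ∉ V := by
    by_contra! h
    exact hVproper (V.eq_top_iff'.mpr h)
  have hne : MulAut.conj (w : FreeGroup X ⧸ V) ≠ 1 := by
    rw [Ne, map_eq_one_iff _ (MulAut.conj_injective_of_center_eq_bot hc),
      QuotientGroup.eq_one_iff]
    exact hw
  refine ⟨_, hne, le_antisymm ?_ (FreeGroup.mk_le_mk_setOf_isConj V hV hc hne)⟩
  calc _ ≤ #(FreeGroup X ⧸ V) := MulAut.mk_setOf_isConj_conj_le _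
    _ ≤ #(FreeGroup X) := mk_le_of_surjective QuotientGroup.mk_surjective
    _ = #X := by rw [mk_freeGroup, max_eq_left (aleph0_le_mk X)]
end
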